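/- There is an absolute constant C > 0 such that for every ε > 0 and every integer t ≥ 3 there exists n₁ = n₁(ε,t) with the following property: every finite simple graph G on n ≥ n₁ vertices with d(G) ≥ c(t) + ε contains a K_t-minor of order at most C·(c(t)·t²/ε)·log n·(log log n)³. -/

import Mathlib

open Real

/-- Edge density `d(G) = |E(G)|/|V(G)|`. -/
noncomputable def density {V : Type*} (G : SimpleGraph V) : ℝ :=
  G.edgeSet.ncard / Nat.card V

/-- External neighborhood `N(S)`: vertices outside `S` adjacent to some vertex of `S`. -/
def nbhd {V : Type*} (G : SimpleGraph V) (S : Set V) : Set V :=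
  {v | v ∉ S ∧ ∃ u ∈ S, G.Adj u v}

/-- `G` contains a `K_t`-minor (branch sets are disjoint, nonempty, connected,
pairwise joined by an edge). -/
def HasKtMinor {V : Type*} (G : SimpleGraph V) (t : ℕ) : Prop :=
  ∃ P : Fin t → Set V,
    (∀ i, (P i).Nonempty) ∧
    (Pairwise (Function.onFun Disjoint P)) ∧
    (∀ i, (G.induce (P i)).Connected) ∧
    (∀ i j : Fin t, i < j → ∃ u ∈ P i, ∃ v ∈ P j, G.Adj u v)

/-- `G` contains a `K_t`-minor of order at most `k`. -/
def HasKtMinorOfOrder {V : Type*} (G : SimpleGraph V) (t : ℕ) (k : ℝ) : Prop :=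
  ∃ P : Fin t → Set V,
    (∀ i, (P i).Nonempty) ∧
    (Pairwise (Function.onFun Disjoint P)) ∧
    (∀ i, (G.induce (P i)).Connected) ∧
    (∀ i j : Fin t, i < j → ∃ u ∈ P i, ∃ v ∈ P j, G.Adj u v) ∧
    ((⋃ i, P i).ncard : ℝ) ≤ k

/-- `c(t)`: the least `c` such that every graph of density at least `c` has a `K_t`-minor. -/
noncomputable def minorThreshold (t : ℕ) : ℝ :=
  sInf {c : ℝ | ∀ (n : ℕ) (G : SimpleGraph (Fin n)), density G ≥ c → HasKtMinor G t}

/-- `δ`-expander. -/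
def IsDeltaExpander {V : Type*} (G : SimpleGraph V) (δ : ℝ) : Prop :=
  ∀ d : ℕ, (d : ℝ) ≤ logb 2 (logb 2 (Nat.card V)) - 1 →
    ∀ S : Set V, (S.ncard : ℝ) ≤ (Nat.card V : ℝ) / (2 : ℝ) ^ (2 ^ d : ℕ) →
      ((nbhd G S).ncard : ℝ) ≥
        δ * 2 ^ d / (logb 2 (Nat.card V) * (logb 2 (logb 2 (Nat.card V))) ^ 2) * S.ncard

/-- `(δ, n)`-expander. -/
def IsDeltaNExpander {V : Type*} (G : SimpleGraph V) (δ : ℝ) (n : ℕ) : Prop :=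
  ∀ d : ℕ, (d : ℝ) ≤ logb 2 (logb 2 (Nat.card V)) - 1 →
    ∀ S : Set V, (S.ncard : ℝ) ≤ (Nat.card V : ℝ) / (2 : ℝ) ^ (2 ^ d : ℕ) →
      ((nbhd G S).ncard : ℝ) ≥ δ * 2 ^ d / logb 2 n * S.ncard

/-- `B_k(v)`: ball of radius `k` around the vertex `v`. -/
def gball {V : Type*} (G : SimpleGraph V) (v : V) (k : ℕ) : Set V :=
  {u | ∃ p : G.Walk v u, p.length ≤ k}

/-- `B_k(U)`: ball of radius `k` around the vertex set `U`. -/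
def gballSet {V : Type*} (G : SimpleGraph V) (U : Set V) (k : ℕ) : Set V :=
  {v | ∃ u ∈ U, ∃ p : G.Walk u v, p.length ≤ k}

/-- A graph `H` is a `γ`-expanding ball: it is covered by a ball `B_k(v)` all of whose
intermediate balls expand by a factor `1 + γ`. -/
def GraphIsExpandingBall {V : Type*} (H : SimpleGraph V) (γ : ℝ) : Prop :=
  ∃ (v : V) (k : ℕ), gball H v k = Set.univ ∧
    ∀ i : ℕ, 1 ≤ i → i + 1 ≤ k →
      ((gball H v (i + 1)).ncard : ℝ) ≥ (1 + γ) * (gball H v i).ncard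

section Mader

open scoped Classical in
/-- Ordered pairs of adjacent vertices inside `W`; there are twice as many as edges inside `W`. -/
noncomputable def adjPairs {V : Type*} (G : SimpleGraph V) (W : Finset V) : Finset (V × V) :=
  (W ×ˢ W).filter fun p => G.Adj p.1 p.2

variable {V : Type*} {G : SimpleGraph V}

theorem mem_adjPairs {W : Finset V} {p : V × V} :
    p ∈ adjPairs G W ↔ (p.1 ∈ W ∧ p.2 ∈ W) ∧ G.Adj p.1 p.2 := by
  simp [adjPairs]

open scoped Classical in
theorem card_adjPairs (W : Finset V) :
    (adjPairs G W).card = ∑ v ∈ W, (W.filter (G.Adj v)).card := by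
  simp only [adjPairs, Finset.card_filter, Finset.sum_product]

open scoped Classical in
theorem card_adjPairs_le_erase [DecidableEq V] (T : Finset V) (v : V) :
    (adjPairs G T).card ≤ (adjPairs G (T.erase v)).card + 2 * (T.filter (G.Adj v)).card := by
  have hsub : adjPairs G T ⊆ adjPairs G (T.erase v) ∪
      ((T.filter (G.Adj v)).image (fun x => (v, x)) ∪
        (T.filter (G.Adj v)).image (fun x => (x, v))) := by
    rintro ⟨a, b⟩ h
    simp only [mem_adjPairs, Finset.mem_union, Finset.mem_image, Finset.mem_filter,
      Finset.mem_erase, Prod.mk.injEq] at h ⊢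
    by_cases ha : a = v
    · subst ha; exact Or.inr (Or.inl ⟨b, ⟨h.1.2, h.2⟩, rfl, rfl⟩)
    by_cases hb : b = v
    · subst hb; exact Or.inr (Or.inr ⟨a, ⟨h.1.1, h.2.symm⟩, rfl, rfl⟩)
    exact Or.inl ⟨⟨⟨ha, h.1.1⟩, hb, h.1.2⟩, h.2⟩
  refine (Finset.card_le_card hsub).trans ((Finset.card_union_le _ _).trans ?_)
  have h1 := Finset.card_union_le ((T.filter (G.Adj v)).image (fun x => (v, x)))
    ((T.filter (G.Adj v)).image (fun x => (x, v)))
  have h2 : ((T.filter (G.Adj v)).image (fun x => (v, x))).card ≤ _ := Finset.card_image_le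
  have h3 : ((T.filter (G.Adj v)).image (fun x => (x, v))).card ≤ _ := Finset.card_image_le
  omega

/-- A connected set dominating the vertices of a `K_t`-minor extends it to a `K_{t+1}`-minor. -/
theorem exists_minor_succ {t : ℕ} {U : Set V} (hUc : (G.induce U).Connected) {N : Set V}
    (hUN : Disjoint U N) (hN : ∀ v ∈ N, ∃ u ∈ U, G.Adj u v) {P : Fin t → Set V}
    (hne : ∀ i, (P i).Nonempty) (hdis : Pairwise (Function.onFun Disjoint P))
    (hconn : ∀ i, (G.induce (P i)).Connected)
    (hadj : ∀ i j : Fin t, i < j → ∃ u ∈ P i, ∃ v ∈ P j, G.Adj u v) (hsub : ∀ i, P i ⊆ N) :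
    ∃ Q : Fin (t + 1) → Set V, (∀ i, (Q i).Nonempty) ∧ Pairwise (Function.onFun Disjoint Q) ∧
      (∀ i, (G.induce (Q i)).Connected) ∧
      (∀ i j : Fin (t + 1), i < j → ∃ u ∈ Q i, ∃ v ∈ Q j, G.Adj u v) ∧
      ∀ i, Q i ⊆ U ∪ N := by
  refine ⟨Fin.cons U P, ?_, ?_, ?_, ?_, ?_⟩
  · intro i
    refine Fin.cases ?_ (fun i => ?_) i
    · obtain ⟨x⟩ := hUc.nonempty
      exact ⟨x.1, x.2⟩
    · simpa using hne i
  · intro i j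
    refine Fin.cases ?_ (fun i => ?_) i <;> refine Fin.cases ?_ (fun j => ?_) j
    · intro h; exact absurd rfl h
    · intro _
      simpa [Function.onFun] using hUN.mono_right (hsub j)
    · intro _
      simpa [Function.onFun] using (hUN.mono_right (hsub i)).symm
    · intro h
      have : i ≠ j := fun e => h (by rw [e])
      simpa [Function.onFun] using hdis this
  · intro i
    refine Fin.cases ?_ (fun i => ?_) i
    · exact hUc
    · exact hconn i
  · intro i j
    refine Fin.cases ?_ (fun i => ?_) i <;> refine Fin.cases ?_ (fun j => ?_) j
    · intro h; exact absurd h (lt_irrefl _)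
    · intro _
      obtain ⟨v, hv⟩ := hne j
      obtain ⟨u, hu, huv⟩ := hN v (hsub j hv)
      exact ⟨u, by simpa using hu, v, by simpa using hv, huv⟩
    · intro h
      exact absurd h (by simp)
    · intro h
      simpa using hadj i j (by simpa using h)
  · intro i
    refine Fin.cases ?_ (fun i => ?_) i
    · simp
    · simpa using (hsub i).trans Set.subset_union_right

theorem connected_induce_singleton (v : V) : (G.induce {v}).Connected := by
  rw [SimpleGraph.induce_singleton_eq_top]
  exact SimpleGraph.connected_top

theorem connected_induce_insert {U : Set V} (hU : (G.induce U).Connected) {u v : V} (hu : u ∈ U)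
    (huv : G.Adj u v) : (G.induce (insert v U)).Connected := by
  have h := G.induce_union_connected hU.preconnected
    (G.induce_pair_connected_of_adj huv).preconnected ⟨u, hu, by simp⟩
  have e : U ∪ {u, v} = insert v U := by
    ext x; simp only [Set.mem_union, Set.mem_insert_iff, Set.mem_singleton_iff]
    constructor
    · rintro (h | rfl | rfl) <;> simp_all
    · rintro (rfl | h) <;> simp_all
  rwa [e] at h

open scoped Classical in
/-- Every vertex set spanning at least `2 ^ t` edges per vertex contains a `K_t`-minor. -/
theorem exists_minor_of_two_pow [DecidableEq V] (G : SimpleGraph V) (t : ℕ) :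
    ∀ W : Finset V, W.Nonempty →
    2 * 2 ^ t * W.card ≤ (adjPairs G W).card →
    ∃ P : Fin t → Set V, (∀ i, (P i).Nonempty) ∧ Pairwise (Function.onFun Disjoint P) ∧
      (∀ i, (G.induce (P i)).Connected) ∧
      (∀ i j : Fin t, i < j → ∃ u ∈ P i, ∃ v ∈ P j, G.Adj u v) ∧ ∀ i, P i ⊆ (W : Set V) := by
  induction t with
  | zero =>
    intro W _ _
    exact ⟨fun _ => ∅, fun i => i.elim0, fun i => i.elim0, fun i => i.elim0, fun i => i.elim0,
      fun i => i.elim0⟩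
  | succ t iht =>
    intro W
    induction W using Finset.strongInduction with
    | H W ihW =>
    intro hW hdense
    set d := 2 ^ (t + 1) with hd
    have hdpos : 0 < d := by positivity
    let N : Finset V → Finset V := fun U => (W \ U).filter fun v => ∃ u ∈ U, G.Adj u v
    let good : Finset V → Prop := fun U => U ⊆ W ∧ (G.induce (U : Set V)).Connected ∧
      2 * d * ((W \ U).card + 1) ≤ (adjPairs G (W \ U)).card + 2 * (N U).card
    obtain ⟨w, hw⟩ := hW
    have hstart : good {w} := by
      refine ⟨by simpa using hw, ?_, ?_⟩
      · rw [Finset.coe_singleton]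
        exact connected_induce_singleton w
      have h1 : W \ {w} = W.erase w := Finset.sdiff_singleton_eq_erase w W
      have h2 : W.filter (G.Adj w) ⊆ N {w} := by
        intro x hx
        simp only [Finset.mem_filter, N, Finset.mem_sdiff, Finset.mem_singleton] at hx ⊢
        exact ⟨⟨hx.1, hx.2.ne'⟩, w, rfl, hx.2⟩
      have h3 := Finset.card_le_card h2
      have h4 := card_adjPairs_le_erase (G := G) W w
      rw [h1, Finset.card_erase_add_one hw]
      omega
    obtain ⟨U, hU, hmax⟩ : ∃ U, good U ∧ ∀ U', good U' → U'.card ≤ U.card := by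
      obtain ⟨U, hU, hmax⟩ := (W.powerset.filter good).exists_max_image Finset.card
        ⟨{w}, by simp [hstart, hw]⟩
      refine ⟨U, (Finset.mem_filter.1 hU).2, fun U' h' => hmax U' ?_⟩
      exact Finset.mem_filter.2 ⟨Finset.mem_powerset.2 h'.1, h'⟩
    obtain ⟨hUW, hUc, hUd⟩ := hU
    have hUne : U.Nonempty := by
      obtain ⟨x⟩ := hUc.nonempty
      exact ⟨x.1, x.2⟩
    by_cases hN : (N U).Nonempty
    · have hdeg : ∀ v ∈ N U, d ≤ ((N U).filter (G.Adj v)).card := by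
        intro v hv
        obtain ⟨hvT, u, hu, huv⟩ := Finset.mem_filter.1 hv
        obtain ⟨hvW, hvU⟩ := Finset.mem_sdiff.1 hvT
        have hbad : ¬ good (insert v U) := by
          intro h
          have := hmax _ h
          rw [Finset.card_insert_of_notMem hvU] at this
          omega
        have hconn : (G.induce ((insert v U : Finset V) : Set V)).Connected := by
          rw [Finset.coe_insert]
          exact connected_induce_insert hUc hu huv
        have hT : W \ insert v U = (W \ U).erase v := by
          ext x; simp only [Finset.mem_sdiff, Finset.mem_insert, Finset.mem_erase]; tauto
        have hlt : (adjPairs G ((W \ U).erase v)).card + 2 * (N (insert v U)).card <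
            2 * d * (W \ U).card := by
          by_contra hcon
          refine hbad ⟨Finset.insert_subset hvW hUW, hconn, ?_⟩
          rw [hT, Finset.card_erase_add_one hvT]
          omega
        have hp := card_adjPairs_le_erase (G := G) (W \ U) v
        have hNsub : (N U).erase v ∪ ((W \ U).filter (G.Adj v) \ N U) ⊆ N (insert v U) := by
          intro x hx
          simp only [N, Finset.mem_union, Finset.mem_erase, Finset.mem_filter, Finset.mem_sdiff,
            Finset.mem_insert] at hx ⊢
          rcases hx with ⟨hxv, ⟨hxW, hxU⟩, y, hy, hyx⟩ | ⟨⟨⟨hxW, hxU⟩, hvx⟩, -⟩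
          · exact ⟨⟨hxW, by tauto⟩, y, Or.inr hy, hyx⟩
          · exact ⟨⟨hxW, by rintro (rfl | h); exacts [hvx.ne rfl, hxU h]⟩, v, Or.inl rfl, hvx⟩
        have hNc := Finset.card_le_card hNsub
        rw [Finset.card_union_of_disjoint (by
          rw [Finset.disjoint_left]; intro x hx hx'
          exact (Finset.mem_sdiff.1 hx').2 (Finset.mem_of_mem_erase hx))] at hNc
        have he := Finset.card_erase_add_one hv
        have hsplit : ((W \ U).filter (G.Adj v)).card ≤
            ((W \ U).filter (G.Adj v) \ N U).card + ((N U).filter (G.Adj v)).card := by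
          rw [← Finset.card_sdiff_add_card_inter ((W \ U).filter (G.Adj v)) (N U)]
          gcongr
          intro x hx
          simp only [Finset.mem_inter, Finset.mem_filter] at hx ⊢
          exact ⟨hx.2, hx.1.2⟩
        have hUd' : 2 * d * (W \ U).card + 2 * d ≤ (adjPairs G (W \ U)).card + 2 * (N U).card := by
          linarith [hUd]
        omega
      have hNd : 2 * 2 ^ t * (N U).card ≤ (adjPairs G (N U)).card := by
        rw [card_adjPairs]
        calc 2 * 2 ^ t * (N U).card = ∑ _v ∈ N U, d := by
              rw [Finset.sum_const, smul_eq_mul, hd, pow_succ]; ring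
          _ ≤ _ := Finset.sum_le_sum hdeg
      obtain ⟨P, h1, h2, h3, h4, h5⟩ := iht (N U) hN hNd
      have hUN : Disjoint (U : Set V) (N U : Set V) := by
        rw [Finset.disjoint_coe, Finset.disjoint_left]
        intro x hx hx'
        exact (Finset.mem_sdiff.1 (Finset.mem_filter.1 hx').1).2 hx
      obtain ⟨Q, q1, q2, q3, q4, q5⟩ := exists_minor_succ hUc hUN
        (fun v hv => (Finset.mem_filter.1 (Finset.mem_coe.1 hv)).2) h1 h2 h3 h4 h5
      refine ⟨Q, q1, q2, q3, q4, fun i => (q5 i).trans ?_⟩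
      refine Set.union_subset (by exact_mod_cast hUW) ?_
      intro x hx
      exact (Finset.mem_sdiff.1 (Finset.mem_filter.1 (Finset.mem_coe.1 hx)).1).1
    · rw [Finset.not_nonempty_iff_eq_empty] at hN
      rw [hN, Finset.card_empty, mul_zero, add_zero] at hUd
      have hT : (W \ U).Nonempty := by
        rw [Finset.nonempty_iff_ne_empty]
        intro h
        rw [h] at hUd
        simp [adjPairs] at hUd
        omega
      obtain ⟨P, h1, h2, h3, h4, h5⟩ := ihW (W \ U) (Finset.sdiff_ssubset hUW hUne) hT
        (le_trans (Nat.mul_le_mul_left _ (Nat.le_succ _)) hUd)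
      refine ⟨P, h1, h2, h3, h4, fun i => (h5 i).trans ?_⟩
      exact_mod_cast Finset.sdiff_subset

end Mader

section Threshold

open scoped Classical in
theorem card_adjPairs_univ {V : Type*} [Fintype V] (G : SimpleGraph V) :
    (adjPairs G Finset.univ).card = 2 * G.edgeSet.ncard := by
  rw [card_adjPairs, Set.ncard_eq_toFinset_card', ← SimpleGraph.edgeFinset,
    ← G.sum_degrees_eq_twice_card_edges]
  refine Finset.sum_congr rfl fun v _ => ?_
  rw [← G.card_neighborFinset_eq_degree, G.neighborFinset_eq_filter]

theorem density_fin {n : ℕ} (G : SimpleGraph (Fin n)) :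
    density G = (adjPairs G Finset.univ).card / 2 / n := by
  rw [density, card_adjPairs_univ]
  simp

theorem bddBelow_minorThreshold {t : ℕ} (ht : 3 ≤ t) :
    (1 / 2 : ℝ) ∈ lowerBounds {c : ℝ | ∀ (n : ℕ) (G : SimpleGraph (Fin n)),
      density G ≥ c → HasKtMinor G t} := by
  intro c hc
  by_contra hlt
  push Not at hlt
  have hd : density (⊤ : SimpleGraph (Fin 2)) = 1 / 2 := by
    rw [density_fin]
    have : adjPairs (⊤ : SimpleGraph (Fin 2)) Finset.univ = {(0, 1), (1, 0)} := by
      ext ⟨a, b⟩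
      simp only [mem_adjPairs, Finset.mem_univ, SimpleGraph.top_adj, Finset.mem_insert,
        Finset.mem_singleton, Prod.mk.injEq]
      fin_cases a <;> fin_cases b <;> simp
    rw [this]
    simp
  obtain ⟨P, hne, hdis, -, -⟩ := hc 2 ⊤ (by rw [hd]; exact hlt.le)
  choose f hf using hne
  have hinj : Function.Injective f := by
    intro i j hij
    by_contra h
    exact Set.disjoint_left.1 (hdis h) (hf i) (hij ▸ hf j)
  have := Fintype.card_le_of_injective f hinj
  simp at this
  omega

theorem half_le_minorThreshold {t : ℕ} (ht : 3 ≤ t) : 1 / 2 ≤ minorThreshold t := by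
  refine le_csInf ⟨(2 : ℝ) ^ t, ?_⟩ (bddBelow_minorThreshold ht)
  intro n G hG
  have hn : n ≠ 0 := by
    rintro rfl
    rw [density_fin] at hG
    have : (0 : ℝ) < 2 ^ t := by positivity
    simp at hG
    linarith
  have : NeZero n := ⟨hn⟩
  have hnpos : (0 : ℝ) < n := by exact_mod_cast Nat.pos_of_ne_zero hn
  rw [density_fin, ge_iff_le, le_div_iff₀ hnpos, le_div_iff₀ two_pos] at hG
  obtain ⟨P, h1, h2, h3, h4, -⟩ := exists_minor_of_two_pow G t Finset.univ
    Finset.univ_nonempty (by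
      have : ((2 * 2 ^ t * n : ℕ) : ℝ) ≤ ((adjPairs G Finset.univ).card : ℕ) := by
        push_cast; linarith
      rw [Finset.card_univ, Fintype.card_fin]
      exact_mod_cast this)
  exact ⟨P, h1, h2, h3, h4⟩

theorem hasKtMinor_of_minorThreshold_lt {t n : ℕ} (ht : 3 ≤ t) {G : SimpleGraph (Fin n)}
    (hG : minorThreshold t < density G) : HasKtMinor G t := by
  have hne : {c : ℝ | ∀ (n : ℕ) (G : SimpleGraph (Fin n)),
      density G ≥ c → HasKtMinor G t}.Nonempty := by
    by_contra h
    rw [Set.not_nonempty_iff_eq_empty] at h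
    have := half_le_minorThreshold ht
    rw [minorThreshold, h, Real.sInf_empty] at this
    linarith
  obtain ⟨c, hc, hlt⟩ := exists_lt_of_csInf_lt hne hG
  exact hc n G hlt.le

theorem HasKtMinorOfOrder.of_comap {V W : Type*} {G : SimpleGraph V} (f : W ↪ V) {t : ℕ} {k : ℝ}
    (h : HasKtMinorOfOrder (G.comap f) t k) : HasKtMinorOfOrder G t k := by
  obtain ⟨P, h1, h2, h3, h4, h5⟩ := h
  refine ⟨fun i => f '' P i, fun i => (h1 i).image f, ?_, ?_, ?_, ?_⟩
  · intro i j hij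
    exact (Set.disjoint_image_iff f.injective).2 (h2 hij)
  · intro i
    let e : (G.comap f).induce (P i) ≃g G.induce (f '' P i) :=
      { toEquiv := Equiv.Set.image f (P i) f.injective
        map_rel_iff' := by intro a b; rfl }
    exact e.connected_iff.1 (h3 i)
  · intro i j hij
    obtain ⟨u, hu, v, hv, huv⟩ := h4 i j hij
    exact ⟨f u, ⟨u, hu, rfl⟩, f v, ⟨v, hv, rfl⟩, huv⟩
  · rw [← Set.image_iUnion, Set.ncard_image_of_injective _ f.injective]
    exact h5

theorem HasKtMinorOfOrder.mono {V : Type*} {G : SimpleGraph V} {t : ℕ} {k l : ℝ}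
    (h : HasKtMinorOfOrder G t k) (hkl : k ≤ l) : HasKtMinorOfOrder G t l := by
  obtain ⟨P, h1, h2, h3, h4, h5⟩ := h
  exact ⟨P, h1, h2, h3, h4, h5.trans hkl⟩

theorem HasKtMinor.hasKtMinorOfOrder {n : ℕ} {G : SimpleGraph (Fin n)} {t : ℕ}
    (h : HasKtMinor G t) : HasKtMinorOfOrder G t n := by
  obtain ⟨P, h1, h2, h3, h4⟩ := h
  refine ⟨P, h1, h2, h3, h4, ?_⟩
  have := Set.ncard_le_card (⋃ i, P i)
  simp only [Nat.card_eq_fintype_card, Fintype.card_fin] at this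
  exact_mod_cast this

end Threshold

section Reach

variable {V : Type*} [Fintype V] [DecidableEq V]

open scoped Classical in
/-- The finite set of vertices outside `S` adjacent to some vertex of `S`. -/
noncomputable def outerNbhd (G : SimpleGraph V) (S : Finset V) : Finset V :=
  Finset.univ.filter fun v => v ∉ S ∧ ∃ u ∈ S, G.Adj u v

/-- One step of breadth-first search from `S` that does not enter `Y`. -/
noncomputable def grow (G : SimpleGraph V) (Y S : Finset V) : Finset V :=
  S ∪ (outerNbhd G S \ Y)

/-- Vertices reachable from `A` in at most `r` steps without entering `Y`. -/
noncomputable def reach (G : SimpleGraph V) (Y A : Finset V) (r : ℕ) : Finset V :=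
  (grow G Y)^[r] A

variable {G : SimpleGraph V} {Y Y' A A' B S : Finset V} {r k : ℕ} {v w : V}

theorem mem_outerNbhd : v ∈ outerNbhd G S ↔ v ∉ S ∧ ∃ u ∈ S, G.Adj u v := by
  simp [outerNbhd]

theorem mem_grow : v ∈ grow G Y S ↔ v ∈ S ∨ (v ∉ Y ∧ ∃ u ∈ S, G.Adj u v) := by
  simp only [grow, Finset.mem_union, Finset.mem_sdiff, mem_outerNbhd]
  tauto

theorem subset_grow : S ⊆ grow G Y S := Finset.subset_union_left

theorem reach_zero : reach G Y A 0 = A := rfl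

theorem reach_succ : reach G Y A (r + 1) = grow G Y (reach G Y A r) :=
  Function.iterate_succ_apply' _ _ _

theorem reach_add : reach G Y A (k + r) = reach G Y (reach G Y A r) k :=
  Function.iterate_add_apply _ _ _ _

theorem reach_subset_succ : reach G Y A r ⊆ reach G Y A (r + 1) := by
  rw [reach_succ]; exact subset_grow

theorem reach_mono_right (h : r ≤ k) : reach G Y A r ⊆ reach G Y A k := by
  induction h with
  | refl => exact subset_rfl
  | step _ ih => exact ih.trans reach_subset_succ

theorem subset_reach : A ⊆ reach G Y A r := reach_mono_right (Nat.zero_le r)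

theorem grow_mono (hY : Y' ⊆ Y) (h : A ⊆ A') : grow G Y A ⊆ grow G Y' A' := by
  intro v hv
  rw [mem_grow] at hv ⊢
  rcases hv with hv | ⟨hv, u, hu, huv⟩
  · exact Or.inl (h hv)
  · exact Or.inr ⟨fun hh => hv (hY hh), u, h hu, huv⟩

theorem reach_mono (hY : Y' ⊆ Y) (h : A ⊆ A') : reach G Y A r ⊆ reach G Y' A' r := by
  induction r with
  | zero => exact h
  | succ r ih => rw [reach_succ, reach_succ]; exact grow_mono hY ih

theorem disjoint_reach (h : Disjoint A Y) : Disjoint (reach G Y A r) Y := by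
  induction r with
  | zero => exact h
  | succ r ih =>
    rw [reach_succ, grow, Finset.disjoint_union_left]
    exact ⟨ih, Finset.sdiff_disjoint⟩

/-- Forbidding vertices that are not reached anyway does not change what is reached. -/
theorem reach_subset_reach_union (h : Disjoint (reach G Y A r) B) :
    reach G Y A r ⊆ reach G (Y ∪ B) A r := by
  induction r with
  | zero => exact subset_rfl
  | succ r ih =>
    intro v hv
    have hvB : v ∉ B := Finset.disjoint_left.1 h hv
    have ih' := ih (h.mono_left reach_subset_succ)
    rw [reach_succ, mem_grow] at hv ⊢
    rcases hv with hv | ⟨hv, u, hu, huv⟩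
    · exact Or.inl (ih' hv)
    · refine Or.inr ⟨?_, u, ih' hu, huv⟩
      rw [Finset.mem_union]; tauto

theorem exists_walk_of_mem_reach (h : v ∈ reach G Y A r) :
    ∃ a ∈ A, ∃ p : G.Walk a v, p.length ≤ r ∧ ∀ x ∈ p.support, x ∈ reach G Y A r := by
  induction r generalizing v with
  | zero => exact ⟨v, h, SimpleGraph.Walk.nil, by simp, by simpa using h⟩
  | succ r ih =>
    have hv := h
    rw [reach_succ, mem_grow] at h
    rcases h with h | ⟨-, u, hu, huv⟩
    · obtain ⟨a, ha, p, hp, hs⟩ := ih h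
      exact ⟨a, ha, p, by omega, fun x hx => reach_subset_succ (hs x hx)⟩
    · obtain ⟨a, ha, p, hp, hs⟩ := ih hu
      refine ⟨a, ha, p.concat huv, by simpa using hp, fun x hx => ?_⟩
      rw [SimpleGraph.Walk.support_concat, List.mem_append] at hx
      rcases hx with hx | hx
      · exact reach_subset_succ (hs x hx)
      · rw [List.mem_singleton] at hx
        exact hx ▸ hv

theorem mem_reach_of_walk {a : V} (p : G.Walk a v) (hp : ∀ x ∈ p.support, x ∉ Y) :
    ∀ {A : Finset V}, a ∈ A → v ∈ reach G Y A p.length := by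
  induction p with
  | nil => intro A ha; exact ha
  | cons h p ih =>
    intro A ha
    rw [SimpleGraph.Walk.length_cons, reach_add]
    refine ih (fun x hx => hp x (by simp [hx])) ?_
    rw [reach_succ, reach_zero, mem_grow]
    exact Or.inr ⟨hp _ (by simp), _, ha, h⟩

theorem mem_reach_symm (hv : v ∉ Y) (h : w ∈ reach G Y {v} r) : v ∈ reach G Y {w} r := by
  obtain ⟨a, ha, p, hp, hs⟩ := exists_walk_of_mem_reach h
  rw [Finset.mem_singleton] at ha
  subst ha
  have hdis : Disjoint (reach G Y {a} r) Y := disjoint_reach (by simpa using hv)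
  have := mem_reach_of_walk (Y := Y) p.reverse
    (fun x hx => Finset.disjoint_left.1 hdis (hs x (by simpa using hx)))
    (Finset.mem_singleton_self w)
  exact reach_mono_right (by simpa using hp) this

theorem card_reach_le {D : ℕ} (hA : Disjoint A Y)
    (hD : ∀ v ∉ Y, (outerNbhd G {v}).card ≤ D) :
    (reach G Y A r).card ≤ A.card * (D + 1) ^ r := by
  induction r with
  | zero => simp [reach_zero]
  | succ r ih =>
    have hdis : Disjoint (reach G Y A r) Y := disjoint_reach hA
    have hsub : outerNbhd G (reach G Y A r) \ Y ⊆
        (reach G Y A r).biUnion fun v => outerNbhd G {v} := by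
      intro v hv
      simp only [Finset.mem_sdiff, mem_outerNbhd, Finset.mem_biUnion,
        Finset.mem_singleton, exists_eq_left] at hv ⊢
      obtain ⟨⟨-, u, hu, huv⟩, -⟩ := hv
      exact ⟨u, hu, huv.ne', huv⟩
    have h1 := (Finset.card_le_card hsub).trans (Finset.card_biUnion_le_card_mul _ _ D
      fun v hv => hD v (Finset.disjoint_left.1 hdis hv))
    rw [reach_succ, grow]
    calc _ ≤ (reach G Y A r).card + (reach G Y A r).card * D :=
          (Finset.card_union_le _ _).trans (by omega)
      _ = (reach G Y A r).card * (D + 1) := by ring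
      _ ≤ A.card * (D + 1) ^ r * (D + 1) := Nat.mul_le_mul_right _ ih
      _ = _ := by ring

theorem card_add_le_card_grow : S.card + (outerNbhd G S).card ≤ (grow G Y S).card + Y.card := by
  rw [grow, Finset.card_union_of_disjoint]
  · have := Finset.le_card_sdiff Y (outerNbhd G S)
    omega
  · rw [Finset.disjoint_left]
    intro x hx hx'
    exact (mem_outerNbhd.1 (Finset.mem_sdiff.1 hx').1).1 hx

/-- Either the search finds a new vertex in each of its steps or it gets stuck. -/
theorem le_card_reach_or (v : V) (r : ℕ) :
    r ≤ (reach G Y {v} r).card ∨ outerNbhd G (reach G Y {v} r) ⊆ Y := by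
  induction r with
  | zero => exact Or.inl (Nat.zero_le _)
  | succ r ih =>
    by_cases hstuck : outerNbhd G (reach G Y {v} r) ⊆ Y
    · right
      rwa [reach_succ, grow, Finset.sdiff_eq_empty_iff_subset.2 hstuck, Finset.union_empty]
    · left
      obtain ⟨x, hx, hxY⟩ := Finset.not_subset.1 hstuck
      have hlt : reach G Y {v} r ⊂ reach G Y {v} (r + 1) := by
        refine Finset.ssubset_iff_subset_ne.2 ⟨reach_subset_succ, fun h => ?_⟩
        rw [mem_outerNbhd] at hx
        apply hx.1
        rw [h, reach_succ, mem_grow]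
        exact Or.inr ⟨hxY, hx.2⟩
      have := Finset.card_lt_card hlt
      have := ih.resolve_right hstuck
      omega

end Reach

section Expansion

variable {V : Type*} [Fintype V] [DecidableEq V]

/-- Every nonempty set `S` of at most half of the vertices has at least
`θ * log (|V| / |S|) * |S|` outer neighbours. -/
def Expands (G : SimpleGraph V) (θ : ℝ) : Prop :=
  ∀ S : Finset V, S.Nonempty → 2 * S.card ≤ Fintype.card V →
    θ * log (Fintype.card V / S.card) * S.card ≤ (outerNbhd G S).card

variable {G : SimpleGraph V} {Y A : Finset V} {θ η : ℝ}

theorem Expands.mul_card_le (hG : Expands G θ) (hθ : 0 ≤ θ)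
    (hη : η ≤ θ * log (Fintype.card V) / 2) (hV : 4 ≤ Fintype.card V) {S : Finset V}
    (hS : S.Nonempty) (hcard : S.card ^ 2 ≤ Fintype.card V) :
    η * S.card ≤ (outerNbhd G S).card := by
  have hpos : (0 : ℝ) < S.card := by exact_mod_cast hS.card_pos
  have hVpos : (0 : ℝ) < Fintype.card V := by exact_mod_cast (by omega : 0 < Fintype.card V)
  have h2 : 2 * S.card ≤ Fintype.card V := by nlinarith
  refine le_trans ?_ (hG S hS h2)
  have hlog : log (Fintype.card V) / 2 ≤ log (Fintype.card V / S.card) := by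
    rw [log_div hVpos.ne' hpos.ne']
    have : log ((S.card : ℝ) ^ 2) ≤ log (Fintype.card V) :=
      log_le_log (by positivity) (by exact_mod_cast hcard)
    rw [log_pow] at this
    push_cast at this
    linarith
  have := mul_le_mul_of_nonneg_left hlog hθ
  gcongr
  linarith

theorem Expands.lt_sq_card_reach_or (hG : Expands G θ) (hθ : 0 ≤ θ) (hη0 : 0 ≤ η)
    (hη : η ≤ θ * log (Fintype.card V) / 2) (hV : 4 ≤ Fintype.card V) {s : ℝ} (hs : 0 < s)
    (hA : s ≤ A.card) (hY : Y.card ≤ η * s / 2) (r : ℕ) :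
    Fintype.card V < (reach G Y A r).card ^ 2 ∨ s * (1 + η / 2) ^ r ≤ (reach G Y A r).card := by
  induction r with
  | zero => right; simpa [reach_zero] using hA
  | succ r ih =>
    have hmono := Finset.card_le_card (reach_subset_succ (G := G) (Y := Y) (A := A) (r := r))
    by_cases hlt : Fintype.card V < (reach G Y A r).card ^ 2
    · exact Or.inl (hlt.trans_le (Nat.pow_le_pow_left hmono 2))
    right
    have ih' := ih.resolve_left hlt
    have hsle : s ≤ (reach G Y A r).card :=
      (le_mul_of_one_le_right hs.le (one_le_pow₀ (by linarith))).trans ih'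
    have hne : (reach G Y A r).Nonempty := by
      rw [← Finset.card_pos]; exact_mod_cast hs.trans_le hsle
    have h1 := hG.mul_card_le hθ hη hV hne (not_lt.1 hlt)
    have h2 : ((reach G Y A r).card : ℝ) + (outerNbhd G (reach G Y A r)).card ≤
        (reach G Y A (r + 1)).card + Y.card := by
      rw [reach_succ]; exact_mod_cast card_add_le_card_grow
    have h3 : η * s ≤ η * (reach G Y A r).card := mul_le_mul_of_nonneg_left hsle hη0
    calc s * (1 + η / 2) ^ (r + 1) = s * (1 + η / 2) ^ r * (1 + η / 2) := by ring
      _ ≤ (reach G Y A r).card * (1 + η / 2) := by gcongr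
      _ ≤ _ := by linarith

theorem half_le_log_one_add {w : ℝ} (h0 : 0 ≤ w) (h1 : w ≤ 1) : w / 2 ≤ log (1 + w) := by
  have h := one_sub_inv_le_log_of_pos (by linarith : 0 < 1 + w)
  refine le_trans ?_ h
  have : 1 - (1 + w)⁻¹ = w / (1 + w) := by field_simp; ring
  rw [this]
  exact div_le_div_of_nonneg_left h0 (by linarith) (by linarith)

theorem Expands.card_lt_two_mul_card_reach (hG : Expands G θ) (hθ : 0 < θ)
    (hθV : θ * log (Fintype.card V) ≤ 2) (hA : A.Nonempty) (hY : 4 * Y.card ≤ θ * A.card)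
    {R : ℕ} (hR : (1 - θ / 4) ^ R * log (Fintype.card V) < log 2) :
    Fintype.card V < 2 * (reach G Y A R).card := by
  have hlog2 : (1 / 2 : ℝ) ≤ log 2 := by linarith [log_two_gt_d9]
  have hApos : (0 : ℝ) < A.card := by exact_mod_cast hA.card_pos
  have hVpos : (0 : ℝ) < Fintype.card V :=
    hApos.trans_le (by exact_mod_cast A.card_le_univ)
  have key : ∀ r, Fintype.card V < 2 * (reach G Y A r).card ∨
      log (Fintype.card V / (reach G Y A r).card) ≤ (1 - θ / 4) ^ r * log (Fintype.card V) := by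
    intro r
    induction r with
    | zero =>
      right
      rw [pow_zero, one_mul, reach_zero, log_div hVpos.ne' hApos.ne']
      have : 0 ≤ log (A.card : ℝ) := log_natCast_nonneg _
      linarith
    | succ r ih =>
      have hmono := Finset.card_le_card (reach_subset_succ (G := G) (Y := Y) (A := A) (r := r))
      by_cases hlt : Fintype.card V < 2 * (reach G Y A r).card
      · left; omega
      right
      have ih' := ih.resolve_left hlt
      have hle := not_lt.1 hlt
      have hsub : (A.card : ℝ) ≤ (reach G Y A r).card := by
        exact_mod_cast Finset.card_le_card subset_reach
      have hne : (reach G Y A r).Nonempty := hA.mono subset_reach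
      set x : ℝ := ((reach G Y A r).card : ℝ) with hx
      have hxpos : 0 < x := hApos.trans_le hsub
      set z := log (Fintype.card V / x) with hz
      have hz2 : log 2 ≤ z := by
        refine log_le_log two_pos ?_
        rw [le_div_iff₀ hxpos, hx]; exact_mod_cast hle
      have hzL : z ≤ log (Fintype.card V) := by
        rw [hz, log_div hVpos.ne' hxpos.ne']
        have : 0 ≤ log x := log_natCast_nonneg _
        linarith
      have h1 : θ * z * x ≤ (outerNbhd G (reach G Y A r)).card := hG _ hne hle
      have h2 : x + (outerNbhd G (reach G Y A r)).card ≤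
          (reach G Y A (r + 1)).card + Y.card := by
        rw [reach_succ, hx]; exact_mod_cast card_add_le_card_grow
      have h3 : θ * A.card ≤ θ * x := by gcongr
      have h4 : θ * x * (1 / 2) ≤ θ * x * z := by gcongr; linarith
      have h5 : x * (1 + θ * z / 2) ≤ (reach G Y A (r + 1)).card := by nlinarith
      have hw0 : 0 ≤ θ * z / 2 := by
        have : 0 ≤ θ * z := mul_nonneg hθ.le (by linarith)
        linarith
      have hw1 : θ * z / 2 ≤ 1 := by
        have : θ * z ≤ θ * log (Fintype.card V) := by gcongr
        linarith
      have hx' : (0 : ℝ) < (reach G Y A (r + 1)).card := lt_of_lt_of_le (by positivity) h5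
      have h6 : log x + log (1 + θ * z / 2) ≤ log (reach G Y A (r + 1)).card := by
        rw [← log_mul hxpos.ne' (by positivity)]
        exact log_le_log (by positivity) h5
      have h7 := half_le_log_one_add hw0 hw1
      have hz' : z = log (Fintype.card V) - log x := log_div hVpos.ne' hxpos.ne'
      rw [log_div hVpos.ne' hx'.ne']
      have h8 : (1 - θ / 4) * z ≤ (1 - θ / 4) * ((1 - θ / 4) ^ r * log (Fintype.card V)) := by
        refine mul_le_mul_of_nonneg_left ih' ?_
        nlinarith
      calc _ ≤ (1 - θ / 4) * z := by linarith
        _ ≤ _ := h8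
        _ = _ := by ring
  rcases key R with h | h
  · exact h
  have h' := h.trans_lt hR
  have hpos : (0 : ℝ) < (reach G Y A R).card := by
    exact_mod_cast (hA.mono subset_reach).card_pos
  have := (log_lt_log_iff (by positivity) two_pos).1 h'
  rw [div_lt_iff₀ hpos] at this
  exact_mod_cast this

end Expansion

section Linking

variable {V : Type*} [DecidableEq V] {G : SimpleGraph V}

theorem SimpleGraph.Walk.exists_walk_to_first_mem {a b : V} (p : G.Walk a b) {B : Finset V}
    (hb : b ∈ B) (ha : a ∉ B) :
    ∃ x e : V, ∃ q : G.Walk a x, G.Adj x e ∧ e ∈ B ∧ q.support ⊆ p.support ∧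
      (∀ y ∈ q.support, y ∉ B) ∧ q.length ≤ p.length := by
  induction p with
  | nil => exact absurd hb ha
  | @cons a c b h p ih =>
    by_cases hc : c ∈ B
    · exact ⟨a, c, SimpleGraph.Walk.nil, h, hc, by simp, by simpa using ha, by simp⟩
    · obtain ⟨x, e, q, h1, h2, h3, h4, h5⟩ := ih hb hc
      refine ⟨x, e, SimpleGraph.Walk.cons h q, h1, h2, ?_, ?_, by simpa using h5⟩
      · simp only [SimpleGraph.Walk.support_cons]
        exact List.cons_subset_cons a h3
      · intro y hy
        rw [SimpleGraph.Walk.support_cons, List.mem_cons] at hy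
        rcases hy with rfl | hy
        exacts [ha, h4 y hy]

/-- A walk from `A` to `B` contains the vertices of a path whose inner part `F` avoids `A ∪ B`. -/
theorem SimpleGraph.Walk.exists_link {a b : V} (p : G.Walk a b) {A B : Finset V}
    (ha : a ∈ A) (hb : b ∈ B) (hAB : Disjoint A B) :
    ∃ F : Finset V, F.card ≤ p.length + 1 ∧ Disjoint F A ∧ Disjoint F B ∧
      (∀ y ∈ F, y ∈ p.support) ∧ ∃ e ∈ A, ∃ e' ∈ B, ∃ x ∈ insert e F, G.Adj x e' ∧
        (G.induce ((insert e F : Finset V) : Set V)).Connected := by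
  obtain ⟨x, e', q, hxe, he', hqs, hqB, hql⟩ :=
    p.exists_walk_to_first_mem hb (Finset.disjoint_left.1 hAB ha)
  by_cases hx : x ∈ A
  · refine ⟨∅, by simp, by simp, by simp, by simp, x, hx, e', he', x, by simp, hxe, ?_⟩
    rw [insert_empty_eq, Finset.coe_singleton]
    exact connected_induce_singleton x
  · obtain ⟨z, e, q', hze, he, hqs', hqA, hql'⟩ := q.reverse.exists_walk_to_first_mem ha hx
    have hsub : ∀ y ∈ q'.support, y ∈ q.support := fun y hy => by simpa using hqs' hy
    refine ⟨q'.support.toFinset, ?_, ?_, ?_, ?_, e, he, e', he', x, by simp, hxe, ?_⟩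
    · refine (List.toFinset_card_le _).trans ?_
      rw [SimpleGraph.Walk.length_support]
      rw [SimpleGraph.Walk.length_reverse] at hql'
      omega
    · rw [Finset.disjoint_left]
      exact fun y hy => hqA y (by simpa using hy)
    · rw [Finset.disjoint_left]
      exact fun y hy => hqB y (hsub y (by simpa using hy))
    · exact fun y hy => hqs (hsub y (by simpa using hy))
    · have hc := connected_induce_insert q'.connected_induce_support
        (SimpleGraph.Walk.end_mem_support q') hze
      have : ((insert e q'.support.toFinset : Finset V) : Set V) =
          insert e {y | y ∈ q'.support} := by
        ext y; simp
      rwa [this]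

/-- `F` is the inner part of a path from `A i` to `A j` that avoids all sets `A k`. -/
def IsLink (G : SimpleGraph V) {t : ℕ} (A : Fin t → Finset V) (i j : Fin t)
    (F : Finset V) : Prop :=
  (∀ k, Disjoint F (A k)) ∧ ∃ e ∈ A i, ∃ e' ∈ A j, ∃ x ∈ insert e F, G.Adj x e' ∧
    (G.induce ((insert e F : Finset V) : Set V)).Connected

theorem exists_disjoint_links {t w : ℕ} {A : Fin t → Finset V}
    (h : ∀ i j, i < j → ∀ X : Finset V, (∀ k, Disjoint X (A k)) → X.card ≤ t ^ 2 * w →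
      ∃ F, IsLink G A i j F ∧ Disjoint F X ∧ F.card ≤ w) :
    ∃ F : Fin t × Fin t → Finset V, (∀ p, p.1 < p.2 → IsLink G A p.1 p.2 (F p)) ∧
      (∀ p, (F p).card ≤ w) ∧ Pairwise (Function.onFun Disjoint F) := by
  have key : ∀ E : Finset (Fin t × Fin t), ∃ F : Fin t × Fin t → Finset V,
      (∀ p ∈ E, (p.1 < p.2 → IsLink G A p.1 p.2 (F p)) ∧ (F p).card ≤ w ∧
        ∀ k, Disjoint (F p) (A k)) ∧
      ∀ p ∈ E, ∀ q ∈ E, p ≠ q → Disjoint (F p) (F q) := by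
    intro E
    induction E using Finset.induction_on with
    | empty => exact ⟨fun _ => ∅, by simp, by simp⟩
    | insert p E hp ih =>
      obtain ⟨F, hF, hFd⟩ := ih
      obtain ⟨N, hN1, hN2, hN3, hN4⟩ : ∃ N : Finset V, (p.1 < p.2 → IsLink G A p.1 p.2 N) ∧
          N.card ≤ w ∧ (∀ k, Disjoint N (A k)) ∧ Disjoint N (E.biUnion F) := by
        by_cases hlt : p.1 < p.2
        · obtain ⟨N, h1, h2, h3⟩ := h p.1 p.2 hlt (E.biUnion F)
            (fun k => (Finset.disjoint_biUnion_left _ _ _).2 fun q hq => (hF q hq).2.2 k)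
            (by
              refine (Finset.card_biUnion_le_card_mul _ _ w fun q hq => (hF q hq).2.1).trans ?_
              refine Nat.mul_le_mul_right _ (E.card_le_univ.trans ?_)
              simp [sq])
          exact ⟨N, fun _ => h1, h3, h1.1, h2⟩
        · exact ⟨∅, fun h => absurd h hlt, by simp, by simp, by simp⟩
      have hne : ∀ q ∈ E, q ≠ p := fun q hq e => hp (e ▸ hq)
      refine ⟨Function.update F p N, ?_, ?_⟩
      · intro q hq
        rcases Finset.mem_insert.1 hq with rfl | hq
        · simpa using ⟨hN1, hN2, hN3⟩
        · simpa [Function.update_of_ne (hne q hq)] using hF q hq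
      · intro q hq q' hq' hqq
        rw [Finset.disjoint_biUnion_right] at hN4
        rcases Finset.mem_insert.1 hq with hqp | hqE <;>
          rcases Finset.mem_insert.1 hq' with hqp' | hqE'
        · exact absurd (hqp.trans hqp'.symm) hqq
        · rw [hqp, Function.update_self, Function.update_of_ne (hne q' hqE')]
          exact hN4 q' hqE'
        · rw [hqp', Function.update_self, Function.update_of_ne (hne q hqE)]
          exact (hN4 q hqE).symm
        · rw [Function.update_of_ne (hne q hqE), Function.update_of_ne (hne q' hqE')]
          exact hFd q hqE q' hqE' hqq
  obtain ⟨F, h1, h2⟩ := key Finset.univ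
  exact ⟨F, fun p => (h1 p (Finset.mem_univ p)).1, fun p => (h1 p (Finset.mem_univ p)).2.1,
    fun p q hpq => h2 p (Finset.mem_univ p) q (Finset.mem_univ q) hpq⟩

/-- Linking disjoint connected sets of small radius pairwise yields a small complete minor. -/
theorem hasKtMinorOfOrder_of_links {t w s : ℕ} {A : Fin t → Finset V} {c : Fin t → V}
    (hA : Pairwise (Function.onFun Disjoint A))
    (hK : ∀ i, ∀ e ∈ A i, ∃ K : Finset V, c i ∈ K ∧ e ∈ K ∧ K ⊆ A i ∧ K.card ≤ s ∧
      (G.induce (K : Set V)).Connected)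
    (hc : ∀ i, c i ∈ A i)
    (h : ∀ i j, i < j → ∀ X : Finset V, (∀ k, Disjoint X (A k)) → X.card ≤ t ^ 2 * w →
      ∃ F, IsLink G A i j F ∧ Disjoint F X ∧ F.card ≤ w) :
    HasKtMinorOfOrder G t ((t ^ 2 * (s + w) : ℕ) : ℝ) := by
  obtain ⟨F, hF, hFw, hFd⟩ := exists_disjoint_links h
  have hpair : ∀ i j : Fin t, i < j → ∃ C C' : Finset V, c i ∈ C ∧ c j ∈ C' ∧
      (G.induce (C : Set V)).Connected ∧ (G.induce (C' : Set V)).Connected ∧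
      C.card ≤ s + w ∧ C'.card ≤ s + w ∧ C ⊆ A i ∪ F (i, j) ∧ C' ⊆ A j ∧
      ∃ x ∈ C, ∃ y ∈ C', G.Adj x y := by
    intro i j hij
    obtain ⟨-, e, he, e', he', x, hx, hxe, hconn⟩ := hF (i, j) hij
    obtain ⟨K, hcK, heK, hKA, hKs, hKc⟩ := hK i e he
    obtain ⟨K', hcK', heK', hKA', hKs', hKc'⟩ := hK j e' he'
    have hins : K ∪ insert e (F (i, j)) = K ∪ F (i, j) := by
      rw [Finset.union_insert, Finset.insert_eq_of_mem (Finset.mem_union_left _ heK)]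
    refine ⟨K ∪ F (i, j), K', Finset.mem_union_left _ hcK, hcK', ?_, hKc', ?_, by omega, ?_, hKA',
      x, ?_, e', heK', hxe⟩
    · rw [← hins, Finset.coe_union]
      exact G.induce_union_connected hKc.preconnected hconn.preconnected ⟨e, heK, by simp⟩
    · have := Finset.card_union_le K (F (i, j))
      have := hFw (i, j)
      omega
    · exact Finset.union_subset_union_left hKA
    · rw [← hins]; exact Finset.mem_union_right _ hx
  choose C C' hC hC' hCc hCc' hCs hCs' hCA hCA' hadj using hpair
  have hD : ∀ i l : Fin t, ∃ D : Finset V, c i ∈ D ∧ (G.induce (D : Set V)).Connected ∧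
      D.card ≤ s + w ∧ (∀ x ∈ D, x ∈ A i ∨ i < l ∧ x ∈ F (i, l)) ∧
      (∀ hl : i < l, C i l hl ⊆ D) ∧ ∀ hl : l < i, C' l i hl ⊆ D := by
    intro i l
    rcases lt_trichotomy i l with hl | rfl | hl
    · refine ⟨C i l hl, hC i l hl, hCc i l hl, hCs i l hl, fun x hx => ?_, fun _ => subset_rfl,
        fun h' => absurd h' hl.asymm⟩
      rcases Finset.mem_union.1 (hCA i l hl hx) with hx | hx
      exacts [Or.inl hx, Or.inr ⟨hl, hx⟩]
    · refine ⟨{c i}, by simp, by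
        rw [Finset.coe_singleton]; exact connected_induce_singleton (c i), ?_, ?_,
        fun h' => absurd h' (lt_irrefl _), fun h' => absurd h' (lt_irrefl _)⟩
      · obtain ⟨K, hcK, -, -, hKs, -⟩ := hK i (c i) (hc i)
        have := Finset.card_pos.2 ⟨_, hcK⟩
        rw [Finset.card_singleton]; omega
      · intro x hx
        rw [Finset.mem_singleton] at hx
        exact Or.inl (hx ▸ hc i)
    · exact ⟨C' l i hl, hC' l i hl, hCc' l i hl, hCs' l i hl, fun x hx => Or.inl (hCA' l i hl hx),
        fun h' => absurd h' hl.asymm, fun _ => subset_rfl⟩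
  choose D hD hDc hDs hDA hDC hDC' using hD
  refine ⟨fun i => ⋃ l, (D i l : Set V), ?_, ?_, ?_, ?_, ?_⟩
  · intro i
    exact ⟨c i, Set.mem_iUnion.2 ⟨i, hD i i⟩⟩
  · intro i j hij
    simp only [Function.onFun]
    rw [Set.disjoint_left]
    intro x hx hx'
    obtain ⟨l, hl⟩ := Set.mem_iUnion.1 hx
    obtain ⟨k, hk⟩ := Set.mem_iUnion.1 hx'
    rcases hDA i l x hl with h1 | ⟨hil, h1⟩ <;> rcases hDA j k x hk with h2 | ⟨hjk, h2⟩
    · exact Finset.disjoint_left.1 (hA hij) h1 h2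
    · exact Finset.disjoint_left.1 ((hF (j, k) hjk).1 i) h2 h1
    · exact Finset.disjoint_left.1 ((hF (i, l) hil).1 j) h1 h2
    · refine Finset.disjoint_left.1 (hFd (?_ : (i, l) ≠ (j, k))) h1 h2
      exact fun e => hij (Prod.ext_iff.1 e).1
  · intro i
    show (G.induce (⋃ l, (D i l : Set V))).Connected
    rw [← Set.sUnion_range]
    refine G.induce_sUnion_connected_of_pairwise_not_disjoint ⟨_, i, rfl⟩ ?_ ?_
    · rintro _ _ ⟨l, rfl⟩ ⟨k, rfl⟩
      exact ⟨c i, hD i l, hD i k⟩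
    · rintro _ ⟨l, rfl⟩
      exact hDc i l
  · intro i j hij
    obtain ⟨x, hx, y, hy, hxy⟩ := hadj i j hij
    exact ⟨x, Set.mem_iUnion.2 ⟨j, hDC i j hij hx⟩, y, Set.mem_iUnion.2 ⟨i, hDC' j i hij hy⟩, hxy⟩
  · have hU : (⋃ i, ⋃ l, (D i l : Set V)) =
        ((Finset.univ.biUnion fun p : Fin t × Fin t => D p.1 p.2 : Finset V) : Set V) := by
      ext x; simp
    rw [hU, Set.ncard_coe_finset]
    refine Nat.cast_le.2 ((Finset.card_biUnion_le_card_mul _ _ _ fun p _ => hDs p.1 p.2).trans ?_)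
    simp [sq]

end Linking

section Core

variable {V : Type*} [Fintype V] [DecidableEq V] {G : SimpleGraph V} {θ η : ℝ}

/-- Two sets that both reach more than half of the graph while avoiding `Y` can be linked. -/
theorem Expands.exists_isLink (hG : Expands G θ) (hθ : 0 < θ)
    (hθV : θ * log (Fintype.card V) ≤ 2) {R r : ℕ}
    (hR : (1 - θ / 4) ^ R * log (Fintype.card V) < log 2) {t : ℕ} {A : Fin t → Finset V}
    {i j : Fin t} (hij : Disjoint (A i) (A j)) {X Y : Finset V} (hX : X ⊆ Y)
    (hY : ∀ k, k ≠ i → k ≠ j → A k ⊆ Y) (hA : ∀ k, k = i ∨ k = j → (A k).Nonempty ∧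
      Disjoint (A k) Y ∧ 4 * Y.card ≤ θ * (reach G Y (A k) r).card) :
    ∃ F, IsLink G A i j F ∧ Disjoint F X ∧ F.card ≤ 2 * (R + r) + 1 := by
  obtain ⟨hAi, hdi, hci⟩ := hA i (Or.inl rfl)
  obtain ⟨hAj, hdj, hcj⟩ := hA j (Or.inr rfl)
  have h1 := hG.card_lt_two_mul_card_reach hθ hθV (hAi.mono subset_reach) hci hR
  have h2 := hG.card_lt_two_mul_card_reach hθ hθV (hAj.mono subset_reach) hcj hR
  rw [← reach_add] at h1 h2
  obtain ⟨v, hv⟩ : (reach G Y (A i) (R + r) ∩ reach G Y (A j) (R + r)).Nonempty := by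
    rw [← Finset.card_pos]
    have h3 := Finset.card_union_add_card_inter (reach G Y (A i) (R + r)) (reach G Y (A j) (R + r))
    have h4 := (reach G Y (A i) (R + r) ∪ reach G Y (A j) (R + r)).card_le_univ
    omega
  rw [Finset.mem_inter] at hv
  obtain ⟨a, ha, p, hp, hps⟩ := exists_walk_of_mem_reach hv.1
  obtain ⟨b, hb, q, hq, hqs⟩ := exists_walk_of_mem_reach hv.2
  obtain ⟨F, hF1, hF2, hF3, hF4, hF5⟩ := (p.append q.reverse).exists_link ha hb hij
  have hFY : Disjoint F Y := by
    rw [Finset.disjoint_left]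
    intro y hy
    have := hF4 y hy
    rw [SimpleGraph.Walk.mem_support_append_iff, SimpleGraph.Walk.support_reverse,
      List.mem_reverse] at this
    rcases this with h | h
    exacts [Finset.disjoint_left.1 (disjoint_reach hdi) (hps y h),
      Finset.disjoint_left.1 (disjoint_reach hdj) (hqs y h)]
  refine ⟨F, ⟨fun k => ?_, hF5⟩, hFY.mono_right hX, ?_⟩
  · by_cases hki : k = i
    · exact hki ▸ hF2
    · by_cases hkj : k = j
      · exact hkj ▸ hF3
      · exact hFY.mono_right (hY k hki hkj)
  · rw [SimpleGraph.Walk.length_append, SimpleGraph.Walk.length_reverse] at hF1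
    omega

/-- Many vertices of large degree in an expander yield a small complete minor. -/
theorem Expands.hasKtMinorOfOrder_of_large_degree (hG : Expands G θ) (hθ : 0 < θ)
    (hθV : θ * log (Fintype.card V) ≤ 2) {R t D : ℕ}
    (hR : (1 - θ / 4) ^ R * log (Fintype.card V) < log 2)
    (hD : 4 * ((t ^ 2 * (2 * (R + 1) + 1) + t : ℕ) : ℝ) ≤
      θ * (D - (t ^ 2 * (2 * (R + 1) + 1) + t : ℕ)))
    {C : Finset V} (hC : C.card = t) (hdeg : ∀ v ∈ C, D ≤ (outerNbhd G {v}).card) :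
    HasKtMinorOfOrder G t ((t ^ 2 * (1 + (2 * (R + 1) + 1)) : ℕ) : ℝ) := by
  let e := C.equivFinOfCardEq hC
  let c : Fin t → V := fun i => e.symm i
  have hcC : ∀ i, c i ∈ C := fun i => (e.symm i).2
  have hcinj : Function.Injective c := fun i j h => e.symm.injective (Subtype.ext h)
  refine hasKtMinorOfOrder_of_links (A := fun i => {c i}) (c := c) ?_ ?_ (by simp) ?_
  · intro i j hij
    simpa [Function.onFun] using fun h => hij (hcinj h)
  · intro i e he
    rw [Finset.mem_singleton] at he
    subst he
    refine ⟨{c i}, by simp, by simp, subset_rfl, by simp, ?_⟩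
    rw [Finset.coe_singleton]
    exact connected_induce_singleton (c i)
  · intro i j hij X hX hXc
    have hsub : ∀ k, k = i ∨ k = j →
        c k ∉ X ∪ (Finset.univ.filter fun l => l ≠ i ∧ l ≠ j).image c := by
      intro k hk hmem
      rcases Finset.mem_union.1 hmem with h | h
      · exact Finset.disjoint_left.1 (hX k) h (by simp)
      · obtain ⟨l, hl, hlk⟩ := Finset.mem_image.1 h
        have := hcinj hlk
        simp at hl
        rcases hk with rfl | rfl
        exacts [hl.1 this, hl.2 this]
    have hYc : (X ∪ (Finset.univ.filter fun l => l ≠ i ∧ l ≠ j).image c).card ≤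
        t ^ 2 * (2 * (R + 1) + 1) + t := by
      refine (Finset.card_union_le _ _).trans (Nat.add_le_add hXc ?_)
      refine Finset.card_image_le.trans ((Finset.card_le_univ _).trans (by simp))
    refine hG.exists_isLink hθ hθV hR (r := 1)
      (Y := X ∪ (Finset.univ.filter fun l => l ≠ i ∧ l ≠ j).image c)
      ?_ Finset.subset_union_left ?_ ?_
    · simpa using fun h => hij.ne (hcinj h)
    · intro k hki hkj
      refine subset_trans ?_ Finset.subset_union_right
      simpa using ⟨k, ⟨hki, hkj⟩, rfl⟩
    · intro k hk
      refine ⟨by simp, by simpa using hsub k hk, ?_⟩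
      set Y := X ∪ (Finset.univ.filter fun l => l ≠ i ∧ l ≠ j).image c
      have h1 := card_add_le_card_grow (G := G) (Y := Y) (S := {c k})
      have h2 := hdeg (c k) (hcC k)
      have h3 : D ≤ (reach G Y {c k} 1).card + Y.card := by
        rw [reach_succ, reach_zero]
        omega
      have h3' : (D : ℝ) ≤ (reach G Y {c k} 1).card + Y.card := by exact_mod_cast h3
      have hYc' : (Y.card : ℝ) ≤ (t ^ 2 * (2 * (R + 1) + 1) + t : ℕ) := by exact_mod_cast hYc
      have h4 : θ * (D - (t ^ 2 * (2 * (R + 1) + 1) + t : ℕ)) ≤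
          θ * (reach G Y {c k} 1).card := mul_le_mul_of_nonneg_left (by linarith) hθ.le
      linarith

/-- Deleting few vertices from an expander leaves a vertex in a large component. -/
theorem Expands.exists_large_reach (hG : Expands G θ) (hθ : 0 < θ) (hθ1 : θ ≤ 1) {X : Finset V}
    {s : ℕ} (hX : 4 * X.card < θ * log 2 * Fintype.card V) (hs : 4 * s ≤ Fintype.card V) :
    ∃ v, v ∉ X ∧ s ≤ (reach G X {v} s).card := by
  by_contra! hcon
  have hX4 : 4 * X.card < Fintype.card V := by
    have h1 : θ * log 2 ≤ 1 := by nlinarith [log_two_lt_d9, log_two_gt_d9]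
    have h2 : θ * log 2 * Fintype.card V ≤ 1 * Fintype.card V :=
      mul_le_mul_of_nonneg_right h1 (Nat.cast_nonneg _)
    have h3 : (4 * X.card : ℝ) < Fintype.card V := by linarith
    exact_mod_cast h3
  let 𝓕 := Finset.univ.filter fun S : Finset V =>
    Disjoint S X ∧ outerNbhd G S ⊆ X ∧ 2 * S.card ≤ Fintype.card V
  obtain ⟨S, hS, hmax⟩ := Finset.exists_max_image 𝓕 Finset.card
    ⟨∅, by simp [𝓕, Finset.subset_iff, mem_outerNbhd]⟩
  simp only [𝓕, Finset.mem_filter, Finset.mem_univ, true_and] at hS hmax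
  obtain ⟨hSX, hSN, hS2⟩ := hS
  by_cases h4 : 4 * S.card < Fintype.card V
  · obtain ⟨v, hv⟩ : ∃ v, v ∉ S ∪ X := by
      by_contra! h
      have h1 : (S ∪ X).card = Fintype.card V := by
        rw [Finset.eq_univ_iff_forall.2 h, Finset.card_univ]
      have h2 := Finset.card_union_le S X
      omega
    rw [Finset.mem_union, not_or] at hv
    have hlt := hcon v hv.2
    have hstuck := (le_card_reach_or (G := G) (Y := X) v s).resolve_left (by omega)
    have hgt : S.card < (S ∪ reach G X {v} s).card := by
      refine Finset.card_lt_card (Finset.ssubset_iff.2 ⟨v, hv.1, ?_⟩)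
      refine Finset.insert_subset ?_ Finset.subset_union_left
      exact Finset.mem_union_right _ (subset_reach (Finset.mem_singleton_self v))
    refine absurd (hmax (S ∪ reach G X {v} s) ⟨?_, ?_, ?_⟩) (by omega)
    · exact Finset.disjoint_union_left.2 ⟨hSX, disjoint_reach (by simpa using hv.2)⟩
    · intro x hx
      rw [mem_outerNbhd, Finset.mem_union, not_or] at hx
      obtain ⟨⟨hx1, hx2⟩, u, hu, hux⟩ := hx
      rcases Finset.mem_union.1 hu with hu | hu
      · exact hSN (mem_outerNbhd.2 ⟨hx1, u, hu, hux⟩)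
      · exact hstuck (mem_outerNbhd.2 ⟨hx2, u, hu, hux⟩)
    · have := Finset.card_union_le S (reach G X {v} s)
      omega
  · have hSpos : 0 < S.card := by omega
    have hSpos' : (0 : ℝ) < S.card := by exact_mod_cast hSpos
    have h1 := hG S (Finset.card_pos.1 hSpos) hS2
    have h2 : ((outerNbhd G S).card : ℝ) ≤ X.card := by exact_mod_cast Finset.card_le_card hSN
    have h3 : log 2 ≤ log (Fintype.card V / S.card) := by
      refine log_le_log (by norm_num) ?_
      rw [le_div_iff₀ hSpos']
      exact_mod_cast hS2
    have h5 : θ * log 2 * S.card ≤ θ * log (Fintype.card V / S.card) * S.card :=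
      mul_le_mul_of_nonneg_right (mul_le_mul_of_nonneg_left h3 hθ.le) hSpos'.le
    have h6 : (Fintype.card V : ℝ) ≤ 4 * S.card := by exact_mod_cast not_lt.1 h4
    have h7 : θ * log 2 * Fintype.card V ≤ θ * log 2 * (4 * S.card) :=
      mul_le_mul_of_nonneg_left h6 (mul_nonneg hθ.le (log_nonneg (by norm_num)))
    linarith

/-- In an expander with few vertices of large degree one finds many far apart vertices, each of
which reaches many vertices. -/
theorem Expands.exists_far_apart (hG : Expands G θ) (hθ : 0 < θ) (hθ1 : θ ≤ 1) {Z : Finset V}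
    {D M s t : ℕ} (hZ : Z.card ≤ t) (hD : ∀ v ∉ Z, (outerNbhd G {v}).card ≤ D)
    (hM : 4 * ((t + t * (D + 1) ^ M : ℕ) : ℝ) < θ * log 2 * Fintype.card V)
    (hs : 4 * s ≤ Fintype.card V) :
    ∃ C : Finset V, C.card = t ∧ (∀ v ∈ C, v ∉ Z ∧ s ≤ (reach G Z {v} s).card) ∧
      ∀ v ∈ C, ∀ w ∈ C, v ≠ w → w ∉ reach G Z {v} M := by
  suffices h : ∀ k ≤ t, ∃ C : Finset V, C.card = k ∧
      (∀ v ∈ C, v ∉ Z ∧ s ≤ (reach G Z {v} s).card) ∧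
      ∀ v ∈ C, ∀ w ∈ C, v ≠ w → w ∉ reach G Z {v} M from h t le_rfl
  intro k
  induction k with
  | zero => exact fun _ => ⟨∅, by simp⟩
  | succ k ih =>
    intro hk
    obtain ⟨C, hC, hC1, hC2⟩ := ih (by omega)
    have hcard : (Z ∪ C.biUnion fun v => reach G Z {v} M).card ≤ t + t * (D + 1) ^ M := by
      refine (Finset.card_union_le _ _).trans (Nat.add_le_add hZ ?_)
      refine (Finset.card_biUnion_le_card_mul _ _ ((D + 1) ^ M) fun v hv => ?_).trans
        (Nat.mul_le_mul_right _ (by omega))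
      simpa using card_reach_le (r := M) (A := {v}) (by simpa using (hC1 v hv).1) hD
    obtain ⟨v, hvX, hvs⟩ := hG.exists_large_reach hθ hθ1
      (X := Z ∪ C.biUnion fun v => reach G Z {v} M) (s := s)
      (lt_of_le_of_lt (mul_le_mul_of_nonneg_left (by exact_mod_cast hcard) (by norm_num)) hM) hs
    rw [Finset.mem_union, not_or, Finset.mem_biUnion, not_exists] at hvX
    have hvC : v ∉ C := fun h => hvX.2 v ⟨h, subset_reach (Finset.mem_singleton_self v)⟩
    refine ⟨insert v C, by rw [Finset.card_insert_of_notMem hvC, hC], ?_, ?_⟩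
    · intro w hw
      rcases Finset.mem_insert.1 hw with rfl | hw
      · exact ⟨hvX.1, hvs.trans (Finset.card_le_card
          (reach_mono Finset.subset_union_left subset_rfl))⟩
      · exact hC1 w hw
    · intro x hx y hy hxy hyx
      rcases Finset.mem_insert.1 hx with hxv | hxC <;> rcases Finset.mem_insert.1 hy with hyv | hyC
      · exact hxy (hxv.trans hyv.symm)
      · subst hxv
        exact hvX.2 y ⟨hyC, mem_reach_symm hvX.1 hyx⟩
      · subst hyv
        exact hvX.2 x ⟨hxC, hyx⟩
      · exact hC2 x hxC y hyC hxy hyx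

theorem disjoint_reach_of_notMem_reach {Y : Finset V} {v w : V} {k l M : ℕ} (hw : w ∉ Y)
    (hM : k + l ≤ M) (h : w ∉ reach G Y {v} M) :
    Disjoint (reach G Y {v} k) (reach G Y {w} l) := by
  rw [Finset.disjoint_left]
  intro x hx hx'
  refine h (reach_mono_right (r := l + k) (by omega) ?_)
  rw [reach_add]
  exact reach_mono subset_rfl (Finset.singleton_subset_iff.2 hx) (mem_reach_symm hw hx')

/-- An expander with few vertices of large degree contains a small complete minor. -/
theorem Expands.hasKtMinorOfOrder_of_small_degree (hG : Expands G θ) (hθ : 0 < θ) (hθ1 : θ ≤ 1)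
    (hθV : θ * log (Fintype.card V) ≤ 2) (hη0 : 0 ≤ η) (hη : η ≤ θ * log (Fintype.card V) / 2)
    (hV : 4 ≤ Fintype.card V) {R t D q₀ q₁ r u : ℕ} {s N : ℝ}
    (hR : (1 - θ / 4) ^ R * log (Fintype.card V) < log 2)
    (hu : u = t ^ 2 * (2 * (R + r) + 1)) (ht : 0 < t) (hs0 : 0 < s) (hq₀ : 2 * t ≤ η * q₀)
    (hs : s ≤ (1 + η / 2) ^ q₁) (hsu : 2 * (t + u : ℝ) ≤ η * s)
    (hsV : s ^ 2 ≤ Fintype.card V) (hN : N ≤ s * (1 + η / 2) ^ r)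
    (hN' : 4 * ((t + u + t * (D + 1) ^ (q₀ + q₁) : ℕ) : ℝ) ≤ θ * N)
    (hNV : N ^ 2 ≤ Fintype.card V)
    (hM : 4 * ((t + t * (D + 1) ^ (2 * (q₀ + q₁) + r) : ℕ) : ℝ) < θ * log 2 * Fintype.card V)
    (hqV : 4 * q₀ ≤ Fintype.card V)
    {Z : Finset V} (hZ : Z.card ≤ t) (hD : ∀ v ∉ Z, (outerNbhd G {v}).card ≤ D) :
    HasKtMinorOfOrder G t ((t ^ 2 * (q₀ + q₁ + 1 + (2 * (R + r) + 1)) : ℕ) : ℝ) := by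
  obtain ⟨C, hC, hC1, hC2⟩ := hG.exists_far_apart hθ hθ1 hZ hD hM hqV
  let e := C.equivFinOfCardEq hC
  obtain ⟨c, hcC, hcinj⟩ : ∃ c : Fin t → V, (∀ i, c i ∈ C) ∧ Function.Injective c :=
    ⟨fun i => e.symm i, fun i => (e.symm i).2, fun i j h => e.symm.injective (Subtype.ext h)⟩
  have ht' : (0 : ℝ) < t := by exact_mod_cast ht
  have hq₀pos : (0 : ℝ) < q₀ := by
    by_contra! h
    have h0 : (q₀ : ℝ) = 0 := le_antisymm h (Nat.cast_nonneg _)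
    rw [h0] at hq₀
    linarith
  set q := q₀ + q₁ with hqdef
  have hdisZ : ∀ i, Disjoint ({c i} : Finset V) Z := fun i => by simpa using (hC1 _ (hcC i)).1
  have hfar : ∀ i j, i ≠ j → ∀ k, k ≤ q + r →
      Disjoint (reach G Z {c i} k) (reach G Z {c j} q) := fun i j hij k hk =>
    disjoint_reach_of_notMem_reach (hC1 _ (hcC j)).1 (by omega)
      (hC2 _ (hcC i) _ (hcC j) fun h => hij (hcinj h))
  have hAs : ∀ i, s ≤ (reach G Z {c i} q).card := by
    intro i
    have hadd : reach G Z {c i} q = reach G Z (reach G Z {c i} q₀) q₁ := by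
      rw [← reach_add, hqdef, add_comm]
    have hq₀' : (q₀ : ℝ) ≤ (reach G Z {c i} q₀).card := by exact_mod_cast (hC1 _ (hcC i)).2
    have hZ' : (Z.card : ℝ) ≤ t := by exact_mod_cast hZ
    rw [hadd]
    rcases hG.lt_sq_card_reach_or (Y := Z) hθ.le hη0 hη hV hq₀pos hq₀' (by linarith) q₁ with h | h
    · have h' : (Fintype.card V : ℝ) < (reach G Z (reach G Z {c i} q₀) q₁).card ^ 2 := by
        exact_mod_cast h
      exact (lt_of_pow_lt_pow_left₀ 2 (Nat.cast_nonneg _) (hsV.trans_lt h')).le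
    · refine hs.trans (le_trans ?_ h)
      refine le_mul_of_one_le_left (by positivity) ?_
      exact_mod_cast (by exact_mod_cast hq₀pos : 0 < q₀)
  have hAcard : ∀ i, (reach G Z {c i} q).card ≤ (D + 1) ^ q := fun i => by
    simpa using card_reach_le (r := q) (hdisZ i) hD
  refine hasKtMinorOfOrder_of_links (A := fun i => reach G Z {c i} q) (c := c) ?_ ?_ ?_ ?_
  · exact fun i j hij => hfar i j hij q (by omega)
  · intro i e he
    obtain ⟨a, ha, p, hp, hps⟩ := exists_walk_of_mem_reach he
    rw [Finset.mem_singleton] at ha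
    subst ha
    refine ⟨p.support.toFinset, by simp, by simp, fun x hx => hps x (by simpa using hx), ?_, ?_⟩
    · refine (List.toFinset_card_le _).trans ?_
      rw [SimpleGraph.Walk.length_support]
      omega
    · rw [List.coe_toFinset]
      exact p.connected_induce_support
  · exact fun i => subset_reach (Finset.mem_singleton_self _)
  · intro i j hij X hX hXc
    rw [← hu] at hXc
    set B := (Finset.univ.filter fun l => l ≠ i ∧ l ≠ j).biUnion fun l => reach G Z {c l} q with hB
    have hZX : (Z ∪ X).card ≤ t + u := (Finset.card_union_le _ _).trans (Nat.add_le_add hZ hXc)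
    have hBcard : B.card ≤ t * (D + 1) ^ q := by
      refine (Finset.card_biUnion_le_card_mul _ _ _ fun l _ => hAcard l).trans
        (Nat.mul_le_mul_right _ ((Finset.card_le_univ _).trans (by simp)))
    have hYcard : (Z ∪ X ∪ B).card ≤ t + u + t * (D + 1) ^ q :=
      (Finset.card_union_le _ _).trans (Nat.add_le_add hZX hBcard)
    have hZX' : ((Z ∪ X).card : ℝ) ≤ t + u := by exact_mod_cast hZX
    have hYcard' : ((Z ∪ X ∪ B).card : ℝ) ≤ ((t + u + t * (D + 1) ^ q : ℕ) : ℝ) := by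
      exact_mod_cast hYcard
    have hBdis : ∀ k, k = i ∨ k = j → ∀ l, l ≤ q + r → Disjoint (reach G Z {c k} l) B := by
      intro k hk l hl
      rw [hB, Finset.disjoint_biUnion_right]
      intro m hm
      simp only [Finset.mem_filter, Finset.mem_univ, true_and] at hm
      refine hfar k m ?_ l hl
      rcases hk with rfl | rfl
      exacts [hm.1.symm, hm.2.symm]
    refine hG.exists_isLink hθ hθV hR (r := r) (hfar i j hij.ne q (by omega))
      (Y := Z ∪ X ∪ B) (Finset.subset_union_right.trans Finset.subset_union_left) ?_ ?_
    · intro k hki hkj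
      refine subset_trans ?_ Finset.subset_union_right
      exact Finset.subset_biUnion_of_mem (fun l => reach G Z {c l} q) (by simp [hki, hkj])
    · intro k hk
      refine ⟨⟨c k, subset_reach (Finset.mem_singleton_self _)⟩, ?_, ?_⟩
      · rw [Finset.disjoint_union_right, Finset.disjoint_union_right]
        exact ⟨⟨disjoint_reach (hdisZ k), (hX k).symm⟩, hBdis k hk q (by omega)⟩
      · have hN1 : N ≤ (reach G (Z ∪ X) (reach G Z {c k} q) r).card := by
          rcases hG.lt_sq_card_reach_or (Y := Z ∪ X) hθ.le hη0 hη hV hs0 (hAs k) (by linarith) r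
            with h | h
          · have h' : (Fintype.card V : ℝ) <
                (reach G (Z ∪ X) (reach G Z {c k} q) r).card ^ 2 := by exact_mod_cast h
            exact (lt_of_pow_lt_pow_left₀ 2 (Nat.cast_nonneg _) (hNV.trans_lt h')).le
          · exact hN.trans h
        have hsub : reach G (Z ∪ X) (reach G Z {c k} q) r ⊆ reach G Z {c k} (r + q) := by
          rw [reach_add (k := r) (r := q)]
          exact reach_mono Finset.subset_union_left subset_rfl
        have hdis := (hBdis k hk (r + q) (by omega)).mono_left hsub
        have hcard : ((reach G (Z ∪ X) (reach G Z {c k} q) r).card : ℝ) ≤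
            (reach G (Z ∪ X ∪ B) (reach G Z {c k} q) r).card := by
          exact_mod_cast Finset.card_le_card (reach_subset_reach_union hdis)
        have := mul_le_mul_of_nonneg_left (hN1.trans hcard) hθ.le
        linarith

/-- An expander contains a small complete minor. -/
theorem Expands.hasKtMinorOfOrder (hG : Expands G θ) (hθ : 0 < θ) (hθ1 : θ ≤ 1)
    (hθV : θ * log (Fintype.card V) ≤ 2) (hη0 : 0 ≤ η) (hη : η ≤ θ * log (Fintype.card V) / 2)
    (hV : 4 ≤ Fintype.card V) {R t D q₀ q₁ r u : ℕ} {s N : ℝ}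
    (hR : (1 - θ / 4) ^ R * log (Fintype.card V) < log 2) (hr : 1 ≤ r)
    (hu : u = t ^ 2 * (2 * (R + r) + 1)) (ht : 0 < t)
    (hDu : 4 * (t + u : ℝ) ≤ θ * (D - (t + u))) (hs0 : 0 < s) (hq₀ : 2 * t ≤ η * q₀)
    (hs : s ≤ (1 + η / 2) ^ q₁) (hsu : 2 * (t + u : ℝ) ≤ η * s)
    (hsV : s ^ 2 ≤ Fintype.card V) (hN : N ≤ s * (1 + η / 2) ^ r)
    (hN' : 4 * ((t + u + t * (D + 1) ^ (q₀ + q₁) : ℕ) : ℝ) ≤ θ * N)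
    (hNV : N ^ 2 ≤ Fintype.card V)
    (hM : 4 * ((t + t * (D + 1) ^ (2 * (q₀ + q₁) + r) : ℕ) : ℝ) < θ * log 2 * Fintype.card V)
    (hqV : 4 * q₀ ≤ Fintype.card V) :
    HasKtMinorOfOrder G t ((t ^ 2 * (q₀ + q₁ + 1 + (2 * (R + r) + 1)) : ℕ) : ℝ) := by
  by_cases hZ : (Finset.univ.filter fun v => D < (outerNbhd G {v}).card).card ≤ t
  · exact hG.hasKtMinorOfOrder_of_small_degree hθ hθ1 hθV hη0 hη hV hR hu ht hs0 hq₀ hs hsu hsV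
      hN hN' hNV hM hqV hZ (fun v hv => by simpa using hv)
  · obtain ⟨C, hCsub, hC⟩ := Finset.exists_subset_card_eq (not_le.1 hZ).le
    have hle : t ^ 2 * (2 * (R + 1) + 1) + t ≤ t + u := by
      have : t ^ 2 * (2 * (R + 1) + 1) ≤ u := hu ▸ Nat.mul_le_mul_left _ (by omega)
      omega
    have hle' : ((t ^ 2 * (2 * (R + 1) + 1) + t : ℕ) : ℝ) ≤ t + u := by exact_mod_cast hle
    refine (hG.hasKtMinorOfOrder_of_large_degree hθ hθV hR (D := D) ?_ hC fun v hv => ?_).mono ?_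
    · have := mul_le_mul_of_nonneg_left
        (sub_le_sub_left hle' (D : ℝ)) hθ.le
      linarith
    · have := hCsub hv
      rw [Finset.mem_filter] at this
      exact this.2.le
    · exact_mod_cast Nat.mul_le_mul_left _ (by omega)

end Core

section Asymptotics

theorem ceil_le_two_mul {x : ℝ} (hx : 1 ≤ x) : (⌈x⌉₊ : ℝ) ≤ 2 * x := by
  have := Nat.ceil_lt_add_one (by linarith : 0 ≤ x)
  linarith

theorem exp_le_one_add_pow {w x : ℝ} {k : ℕ} (h0 : 0 ≤ w) (h1 : w ≤ 1) (h : x ≤ w / 2 * k) :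
    exp x ≤ (1 + w) ^ k := by
  rw [← exp_log (by linarith : 0 < 1 + w), ← exp_nat_mul]
  refine exp_le_exp.2 (h.trans ?_)
  rw [mul_comm]
  exact mul_le_mul_of_nonneg_left (half_le_log_one_add h0 h1) (Nat.cast_nonneg _)

theorem pow_le_exp_mul {x y : ℝ} {k : ℕ} (hx0 : 0 ≤ x) (hx : x ≤ exp y) :
    x ^ k ≤ exp (y * k) := by
  rw [mul_comm, exp_nat_mul]
  exact pow_le_pow_left₀ hx0 hx k

variable {V : Type*} [Fintype V] [DecidableEq V] {G : SimpleGraph V} {κ b : ℝ}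

set_option maxHeartbeats 1000000 in
theorem Expands.hasKtMinorOfOrder_of_card_eq (hb : 100 ≤ b) (hbe : b ^ 17 ≤ exp b)
    (hκ0 : 0 < κ) (hκ1 : κ ≤ 1) (hκb : 1 ≤ κ * b) (hV : (Fintype.card V : ℝ) = exp (exp b))
    (hG : Expands G (κ / (exp b * b * √b))) {t : ℕ} (ht : 0 < t) (htb : t ≤ b) :
    HasKtMinorOfOrder G t (t ^ 2 * (45 * exp b * b ^ 2 * √b / κ)) := by
  have hb0 : 0 < b := by linarith
  have hE0 : 0 < exp b := exp_pos b
  have hpow : ∀ {i j : ℕ}, i ≤ j → b ^ i ≤ b ^ j := fun h => pow_le_pow_right₀ (by linarith) h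
  have hpow1 : ∀ i : ℕ, 1 ≤ b ^ i := fun i => one_le_pow₀ (by linarith)
  have hpow100 : ∀ {i j : ℕ}, i < j → 100 * b ^ i ≤ b ^ j := fun {i j} h =>
    calc 100 * b ^ i ≤ b * b ^ i := by gcongr
      _ = b ^ (i + 1) := (pow_succ' b i).symm
      _ ≤ b ^ j := hpow h
  have hsqrt1 : 1 ≤ √b := by rw [one_le_sqrt]; linarith
  have hsqrtb : √b ≤ b := by
    rw [sqrt_le_left hb0.le]; nlinarith
  set θ := κ / (exp b * b * √b) with hθdef
  have hθ0 : 0 < θ := by positivity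
  have hlogV : log (Fintype.card V) = exp b := by rw [hV, log_exp]
  have hinv : 1 / θ = exp b * b * √b / κ := by rw [hθdef, one_div_div]
  -- size of `1 / θ`
  have hinv_le : 1 / θ ≤ exp b * b ^ 3 := by
    rw [hinv, div_le_iff₀ hκ0]
    have h1 : exp b * b * √b ≤ exp b * b * b := by gcongr
    have h2 : exp b * b * b * 1 ≤ exp b * b * b * (κ * b) := by gcongr
    calc _ ≤ exp b * b * b * (κ * b) := by linarith
      _ = _ := by ring
  have hinv_ge : exp b * b ≤ 1 / θ := by
    rw [hinv, le_div_iff₀ hκ0]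
    calc exp b * b * κ ≤ exp b * b * √b := by gcongr; linarith
      _ = _ := rfl
  have hinv_exp : 1 / θ ≤ exp (2 * b) := by
    refine hinv_le.trans ?_
    rw [two_mul, exp_add]
    gcongr
    exact (hpow (by norm_num)).trans hbe
  have hθ_ge : exp (-(2 * b)) ≤ θ := by
    rw [exp_neg, inv_le_comm₀ (exp_pos _) hθ0, ← one_div]
    exact hinv_exp
  have hθ1 : θ ≤ 1 := by
    have h1 : 1 ≤ 1 / θ := by
      refine le_trans ?_ hinv_ge
      have : 1 ≤ exp b := by linarith [hpow1 17]
      nlinarith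
    rwa [le_div_iff₀ hθ0, one_mul] at h1
  obtain ⟨η, hη⟩ : ∃ η, η = θ * exp b / 2 := ⟨_, rfl⟩
  have hη_eq : η = κ / (2 * b * √b) := by
    rw [hη, hθdef]; field_simp
  have hη_ge : 1 / (2 * b ^ 3) ≤ η := by
    rw [hη_eq, div_le_div_iff₀ (by positivity) (by positivity)]
    calc 1 * (2 * b * √b) ≤ (κ * b) * (2 * b * b) := by gcongr
      _ = _ := by ring
  have hη_le : η ≤ 1 := by
    rw [hη_eq, div_le_one (by positivity)]
    nlinarith
  have hη0 : 0 ≤ η := le_trans (by positivity) hη_ge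
  obtain ⟨R, hRdef⟩ : ∃ R, R = ⌈4 * (b + 1) * (1 / θ)⌉₊ := ⟨_, rfl⟩
  obtain ⟨q, hqdef⟩ : ∃ q, q = ⌈b ^ 5⌉₊ := ⟨_, rfl⟩
  obtain ⟨r, hrdef⟩ : ∃ r, r = ⌈b ^ 12⌉₊ := ⟨_, rfl⟩
  obtain ⟨D, hDdef⟩ : ∃ D, D = ⌈exp (6 * b)⌉₊ := ⟨_, rfl⟩
  obtain ⟨u, hu⟩ : ∃ u, u = t ^ 2 * (2 * (R + r) + 1) := ⟨_, rfl⟩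
  have hR_ge : 4 * (b + 1) * (1 / θ) ≤ R := hRdef ▸ Nat.le_ceil _
  have hinv1 : b ^ 17 ≤ 1 / θ :=
    (hbe.trans (le_mul_of_one_le_right hE0.le (by linarith))).trans hinv_ge
  have hinv100 : 100 * (1 / θ) ≤ b * (1 / θ) := mul_le_mul_of_nonneg_right hb (by positivity)
  have hR_le : (R : ℝ) ≤ 9 * b * (1 / θ) := by
    have h := Nat.ceil_lt_add_one (a := 4 * (b + 1) * (1 / θ)) (by positivity)
    rw [← hRdef] at h
    linarith [hpow1 17]
  have hq_ge : b ^ 5 ≤ q := hqdef ▸ Nat.le_ceil _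
  have hq_le : (q : ℝ) ≤ 2 * b ^ 5 := hqdef ▸ ceil_le_two_mul (hpow1 5)
  have hr_ge : b ^ 12 ≤ r := hrdef ▸ Nat.le_ceil _
  have hr_le : (r : ℝ) ≤ 2 * b ^ 12 := hrdef ▸ ceil_le_two_mul (hpow1 12)
  have hr1 : 1 ≤ r := by exact_mod_cast (hpow1 12).trans hr_ge
  have hD_ge : exp (6 * b) ≤ D := hDdef ▸ Nat.le_ceil _
  have hexp4 : ∀ {x : ℝ}, 0 ≤ x → x ≤ exp x := fun {x} _ => by linarith [add_one_le_exp x]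
  have hexpb : 100 ≤ exp b := hb.trans (hexp4 hb0.le)
  have hD_le : ((D + 1 : ℕ) : ℝ) ≤ exp (7 * b) := by
    have h1 : (D : ℝ) ≤ 2 * exp (6 * b) := hDdef ▸ ceil_le_two_mul (one_le_exp (by linarith))
    have h2 : exp (7 * b) = exp (6 * b) * exp b := by rw [← exp_add]; ring_nf
    have h3 : 1 ≤ exp (6 * b) := one_le_exp (by linarith)
    push_cast
    rw [h2]
    nlinarith
  have ht0 : (0 : ℝ) ≤ t := Nat.cast_nonneg _
  have htu : (t + u : ℝ) ≤ exp (2 * b) := by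
    have h1 : (u : ℝ) = t ^ 2 * (2 * (R + r) + 1) := by rw [hu]; push_cast; ring
    have h2 : (R : ℝ) ≤ 9 * (exp b * b ^ 4) := by
      calc (R : ℝ) ≤ 9 * b * (exp b * b ^ 3) := hR_le.trans (by gcongr)
        _ = _ := by ring
    have h3 : (r : ℝ) ≤ exp b * b ^ 4 := by
      have h := le_mul_of_one_le_right hE0.le (hpow1 4)
      linarith [hpow100 (show 12 < 17 by norm_num), hpow1 12]
    have h4 : (1 : ℝ) ≤ exp b * b ^ 4 := one_le_mul_of_one_le_of_one_le (by linarith) (hpow1 4)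
    have h5 : (t : ℝ) ^ 2 ≤ b ^ 2 := pow_le_pow_left₀ ht0 htb 2
    have h6 : (u : ℝ) ≤ b ^ 2 * (21 * (exp b * b ^ 4)) := by
      rw [h1]; gcongr; linarith
    have h7 : exp (2 * b) = exp b * exp b := by rw [two_mul, exp_add]
    have h8 : exp b * b ^ 7 ≤ exp b * exp b := by
      gcongr; exact (hpow (by norm_num)).trans hbe
    have h9 : exp b * (100 * b ^ 6) ≤ exp b * b ^ 7 := by
      gcongr; exact hpow100 (show 6 < 7 by norm_num)
    have h10 : b ≤ exp b * b ^ 6 := 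
      (hexp4 hb0.le).trans (le_mul_of_one_le_right hE0.le (hpow1 6))
    rw [h7]
    linarith
  have hu0 : (0 : ℝ) ≤ u := Nat.cast_nonneg _
  have hgrow : ∀ {k : ℕ} {x : ℝ}, x * (8 * b ^ 3) ≤ k → exp x ≤ (1 + η / 2) ^ k := by
    intro k x h
    refine exp_le_one_add_pow (by positivity) (by linarith) ?_
    have h1 : 1 / (8 * b ^ 3) ≤ η / 2 / 2 := by
      have : 1 / (8 * b ^ 3) = 1 / (2 * b ^ 3) / 2 / 2 := by field_simp; norm_num
      rw [this]; gcongr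
    calc x ≤ 1 / (8 * b ^ 3) * k := by
          rw [one_div_mul_eq_div, le_div_iff₀ (by positivity)]; exact h
      _ ≤ _ := by gcongr
  have hpowD : ∀ k : ℕ, (((D + 1) ^ k : ℕ) : ℝ) ≤ exp (7 * b * k) := fun k => by
    rw [Nat.cast_pow]
    exact pow_le_exp_mul (Nat.cast_nonneg _) hD_le
  have hexp_le : ∀ {x : ℝ}, x ≤ exp b → exp x ≤ Fintype.card V := fun h => by
    rw [hV]; exact exp_le_exp.2 h
  have hmin := hG.hasKtMinorOfOrder (η := η) (R := R) (t := t) (D := D) (q₀ := q) (q₁ := q)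
    (r := r) (u := u) (s := exp (4 * b)) (N := exp (b ^ 8)) hθ0 hθ1 ?_ hη0 ?_ ?_ ?_ hr1 hu ht ?_
    (exp_pos _) ?_ ?_ ?_ ?_ ?_ ?_ ?_ ?_ ?_
  · refine hmin.mono ?_
    push_cast
    gcongr
    have h1 : 45 * exp b * b ^ 2 * √b / κ = 45 * b * (1 / θ) := by rw [hinv]; ring
    rw [h1]
    have h2 := hpow (show 5 ≤ 17 by norm_num)
    have h3 := hpow (show 12 ≤ 17 by norm_num)
    have h4 := hpow1 17
    linarith
  · rw [hlogV]
    have : θ * exp b = 2 * η := by rw [hη]; ring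
    linarith
  · rw [hlogV, hη]
  · have h : (4 : ℝ) ≤ Fintype.card V := by
      rw [hV]
      linarith [hexp4 hE0.le]
    exact_mod_cast h
  · rw [hlogV]
    have h1 : (1 - θ / 4) ^ R ≤ exp (-(b + 1)) := by
      have h2 : 1 - θ / 4 ≤ exp (-(θ / 4)) := by linarith [add_one_le_exp (-(θ / 4))]
      refine (pow_le_exp_mul (by linarith) h2).trans (exp_le_exp.2 ?_)
      have h3 : θ / 4 * (4 * (b + 1) * (1 / θ)) ≤ θ / 4 * R := by gcongr
      have h4 : θ / 4 * (4 * (b + 1) * (1 / θ)) = b + 1 := by field_simp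
      linarith
    calc (1 - θ / 4) ^ R * exp b ≤ exp (-(b + 1)) * exp b := by gcongr
      _ = exp (-1) := by rw [← exp_add]; ring_nf
      _ < log 2 := by linarith [exp_neg_one_lt_d9, log_two_gt_d9]
  · have h1 : θ * exp (6 * b) ≥ exp (4 * b) := by
      have h2 : exp (4 * b) = exp (-(2 * b)) * exp (6 * b) := by rw [← exp_add]; ring_nf
      rw [h2]; gcongr
    have h3 : θ * exp (6 * b) ≤ θ * D := by gcongr
    have h4 : exp (4 * b) = exp (2 * b) * exp b * exp b := by
      rw [← exp_add, ← exp_add]; ring_nf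
    have h5 : θ * (t + u) ≤ 1 * (t + u) := by gcongr
    have h6 : exp (2 * b) * 100 ≤ exp (2 * b) * exp b * exp b := by
      rw [mul_assoc]; gcongr
      exact hexpb.trans (le_mul_of_one_le_right hE0.le (by linarith))
    linarith [exp_pos (2 * b)]
  · have h1 : 1 / (2 * b ^ 3) * b ^ 5 ≤ η * q := by gcongr
    have h2 : 1 / (2 * b ^ 3) * b ^ 5 = b * b / 2 := by field_simp
    have h3 : 100 * b ≤ b * b := by gcongr
    linarith
  · refine hgrow (le_trans ?_ hq_ge)
    have := hpow100 (show 4 < 5 by norm_num)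
    calc 4 * b * (8 * b ^ 3) = 32 * b ^ 4 := by ring
      _ ≤ b ^ 5 := by linarith [hpow1 4]
  · have h1 : 1 / (2 * b ^ 3) * exp (4 * b) ≤ η * exp (4 * b) := by gcongr
    refine le_trans ?_ h1
    rw [one_div_mul_eq_div, le_div_iff₀ (by positivity)]
    have h4 : exp (4 * b) = exp (2 * b) * exp b * exp b := by
      rw [← exp_add, ← exp_add]; ring_nf
    have h5 : b ^ 3 ≤ exp b := (hpow (by norm_num)).trans hbe
    calc 2 * (t + u : ℝ) * (2 * b ^ 3) = 4 * ((t + u : ℝ) * b ^ 3) := by ring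
      _ ≤ exp b * (exp (2 * b) * exp b) := by gcongr; linarith
      _ = _ := by rw [h4]; ring
  · rw [← exp_nat_mul]
    refine hexp_le ?_
    have := hpow100 (show 1 < 17 by norm_num)
    rw [pow_one] at this
    push_cast
    linarith
  · have h1 : exp (b ^ 8) ≤ (1 + η / 2) ^ r := by
      refine hgrow (le_trans ?_ hr_ge)
      have := hpow100 (show 11 < 12 by norm_num)
      calc b ^ 8 * (8 * b ^ 3) = 8 * b ^ 11 := by ring
        _ ≤ b ^ 12 := by linarith [hpow1 11]
    exact h1.trans (le_mul_of_one_le_left (by positivity) (one_le_exp (by linarith)))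
  · have h1 : (((D + 1) ^ (q + q) : ℕ) : ℝ) ≤ exp (b ^ 7) := by
      refine (hpowD _).trans (exp_le_exp.2 ?_)
      push_cast
      have h2 : 7 * b * (q + q) ≤ 7 * b * (2 * b ^ 5 + 2 * b ^ 5) := by gcongr
      have := hpow100 (show 6 < 7 by norm_num)
      calc _ ≤ 7 * b * (2 * b ^ 5 + 2 * b ^ 5) := h2
        _ = 28 * b ^ 6 := by ring
        _ ≤ b ^ 7 := by linarith [hpow1 6]
    have h2 : 2 * b ≤ b ^ 7 := by
      have := hpow100 (show 1 < 7 by norm_num)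
      rw [pow_one] at this
      linarith
    have h3 : exp (2 * b) ≤ exp b * exp (b ^ 7) := by
      rw [← exp_add]; exact exp_le_exp.2 (by linarith)
    have h4 : (t : ℝ) ≤ exp b := htb.trans (hexp4 hb0.le)
    have h5 : (t : ℝ) * ((D + 1) ^ (q + q) : ℕ) ≤ exp b * exp (b ^ 7) := by gcongr
    have h6 : exp (-(2 * b)) * exp (b ^ 8) ≤ θ * exp (b ^ 8) := by gcongr
    have h7 : exp b * (exp b * exp (b ^ 7)) ≤ exp (-(2 * b)) * exp (b ^ 8) := by
      rw [← exp_add, ← exp_add, ← exp_add]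
      refine exp_le_exp.2 ?_
      have := hpow100 (show 7 < 8 by norm_num)
      linarith [hpow1 7]
    have h8 : 100 * (exp b * exp (b ^ 7)) ≤ exp b * (exp b * exp (b ^ 7)) := by gcongr
    rw [Nat.cast_add, Nat.cast_add, Nat.cast_mul]
    have h9 : 0 < exp b * exp (b ^ 7) := by positivity
    linarith
  · rw [← exp_nat_mul]
    refine hexp_le ?_
    have := hpow100 (show 8 < 17 by norm_num)
    push_cast
    linarith [hpow1 8]
  · have h1 : (((D + 1) ^ (2 * (q + q) + r) : ℕ) : ℝ) ≤ exp (b ^ 15) := by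
      refine (hpowD _).trans (exp_le_exp.2 ?_)
      push_cast
      have h2 : 7 * b * (2 * (q + q) + r) ≤
          7 * b * (2 * (2 * b ^ 5 + 2 * b ^ 5) + 2 * b ^ 12) := by gcongr
      have := hpow100 (show 13 < 15 by norm_num)
      have := hpow (show 6 ≤ 13 by norm_num)
      calc _ ≤ 7 * b * (2 * (2 * b ^ 5 + 2 * b ^ 5) + 2 * b ^ 12) := h2
        _ = 56 * b ^ 6 + 14 * b ^ 13 := by ring
        _ ≤ b ^ 15 := by linarith [hpow1 13]
    have h4 : (t : ℝ) ≤ exp b := htb.trans (hexp4 hb0.le)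
    have h5 : (t : ℝ) * ((D + 1) ^ (2 * (q + q) + r) : ℕ) ≤ exp b * exp (b ^ 15) := by gcongr
    have h6 : exp b * 1 ≤ exp b * exp (b ^ 15) := by
      gcongr; exact one_le_exp (by positivity)
    have h7 : exp (-(2 * b)) * Fintype.card V ≤ θ * Fintype.card V := by gcongr
    have h8 : exp b * (exp b * exp (b ^ 15)) ≤ exp (-(2 * b)) * Fintype.card V := by
      rw [hV, ← exp_add, ← exp_add, ← exp_add]
      refine exp_le_exp.2 ?_
      have := hpow100 (show 15 < 17 by norm_num)
      have := hpow (show 1 ≤ 15 by norm_num)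
      rw [pow_one] at this
      linarith [hpow1 15]
    have h9 : 100 * (exp b * exp (b ^ 15)) ≤ exp b * (exp b * exp (b ^ 15)) := by gcongr
    have h10 : 0 < exp b * exp (b ^ 15) := by positivity
    have h11 : θ * Fintype.card V * (1 / 2) ≤ θ * Fintype.card V * log 2 := by
      gcongr; linarith [log_two_gt_d9]
    rw [Nat.cast_add, Nat.cast_mul]
    linarith
  · have h : (4 * q : ℝ) ≤ Fintype.card V := by
      have := hexp_le (show b ≤ exp b from hexp4 hb0.le)
      have := hpow100 (show 5 < 17 by norm_num)
      linarith [hpow1 5]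
    exact_mod_cast h

theorem exists_forall_hasKtMinorOfOrder {δ : ℝ} (hκ0 : 0 < κ) (hκ1 : κ ≤ 1) (hδ : 0 < δ) {t : ℕ}
    (ht : 0 < t) : ∃ m₀ : ℕ, ∀ m : ℕ, m₀ ≤ m → ∀ G : SimpleGraph (Fin m),
      Expands G (κ / (log m * log (log m) * √(log (log m)))) →
        HasKtMinorOfOrder G t (δ * t ^ 2 * log m * log (log m) ^ 3) := by
  have hlim : Filter.Tendsto (fun m : ℕ => log (log (m : ℝ))) Filter.atTop Filter.atTop :=
    tendsto_log_atTop.comp (tendsto_log_atTop.comp tendsto_natCast_atTop_atTop)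
  have hpow : ∀ᶠ b : ℝ in Filter.atTop, b ^ 17 ≤ exp b := by
    have h := tendsto_exp_div_pow_atTop 17
    filter_upwards [h.eventually_ge_atTop 1, Filter.eventually_gt_atTop 0] with b hb hb0
    rwa [le_div_iff₀ (by positivity), one_mul] at hb
  have hev : ∀ᶠ m : ℕ in Filter.atTop, ∀ G : SimpleGraph (Fin m),
      Expands G (κ / (log m * log (log m) * √(log (log m)))) →
        HasKtMinorOfOrder G t (δ * t ^ 2 * log m * log (log m) ^ 3) := by
    filter_upwards [hlim.eventually hpow, hlim.eventually_ge_atTop 100,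
      hlim.eventually_ge_atTop (1 / κ), hlim.eventually_ge_atTop (t : ℝ),
      hlim.eventually_ge_atTop ((45 / (κ * δ)) ^ 2),
      tendsto_natCast_atTop_atTop.eventually_gt_atTop (1 : ℝ)] with m h1 h2 h3 h4 h5 h6 G hG
    have hL : 0 < log (m : ℝ) := log_pos h6
    have hexp : exp (log (log (m : ℝ))) = log m := exp_log hL
    set b := log (log (m : ℝ)) with hb
    have hb0 : 0 < b := by linarith
    rw [← hexp] at hG ⊢
    refine (hG.hasKtMinorOfOrder_of_card_eq h2 h1 hκ0 hκ1 ?_ ?_ ht h4).mono ?_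
    · rwa [div_le_iff₀ hκ0, mul_comm] at h3
    · rw [hexp, exp_log (by linarith), Fintype.card_fin]
    · have h7 : 45 / (κ * δ) ≤ √b := le_sqrt_of_sq_le h5
      have h8 : 45 / κ ≤ δ * √b := by
        rw [div_le_iff₀ (by positivity)] at h7 ⊢
        linarith
      calc (t : ℝ) ^ 2 * (45 * exp b * b ^ 2 * √b / κ)
          = t ^ 2 * exp b * b ^ 2 * √b * (45 / κ) := by ring
        _ ≤ t ^ 2 * exp b * b ^ 2 * √b * (δ * √b) := by gcongr
        _ = δ * t ^ 2 * exp b * (b ^ 2 * (√b * √b)) := by ring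
        _ = _ := by rw [mul_self_sqrt hb0.le]; ring
  exact Filter.eventually_atTop.1 hev

end Asymptotics

section MinimalSubgraph

theorem card_adjPairs_comap {V W : Type*} {G : SimpleGraph V} (f : W ↪ V) (S : Finset W) :
    (adjPairs (G.comap f) S).card = (adjPairs G (S.map f)).card := by
  rw [← Finset.card_map (f.prodMap f)]
  congr 1
  ext ⟨x, y⟩
  simp only [Finset.mem_map, mem_adjPairs, Prod.exists, Function.Embedding.coe_prodMap,
    Prod.map_apply, Prod.mk.injEq, SimpleGraph.comap_adj]
  constructor
  · rintro ⟨a, b, ⟨⟨ha, hb⟩, hab⟩, rfl, rfl⟩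
    exact ⟨⟨⟨a, ha, rfl⟩, ⟨b, hb, rfl⟩⟩, hab⟩
  · rintro ⟨⟨⟨a, ha, rfl⟩, ⟨b, hb, rfl⟩⟩, hab⟩
    exact ⟨a, b, ⟨⟨ha, hb⟩, hab⟩, rfl, rfl⟩

variable {V : Type*} [Fintype V] [DecidableEq V] {G : SimpleGraph V}

theorem card_adjPairs_univ_le (S : Finset V) :
    (adjPairs G Finset.univ).card ≤
      (adjPairs G (S ∪ outerNbhd G S)).card + (adjPairs G Sᶜ).card := by
  refine le_trans (Finset.card_le_card ?_) (Finset.card_union_le _ _)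
  rintro ⟨x, y⟩ hxy
  have hadj : G.Adj x y := (mem_adjPairs.1 hxy).2
  rw [Finset.mem_union, mem_adjPairs, mem_adjPairs]
  have key : ∀ {u v : V}, u ∈ S → G.Adj u v → v ∈ S ∪ outerNbhd G S := by
    intro u v hu huv
    by_cases hv : v ∈ S
    · exact Finset.mem_union_left _ hv
    · exact Finset.mem_union_right _ (mem_outerNbhd.2 ⟨hv, u, hu, huv⟩)
  by_cases hx : x ∈ S
  · exact Or.inl ⟨⟨Finset.mem_union_left _ hx, key hx hadj⟩, hadj⟩
  · by_cases hy : y ∈ S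
    · exact Or.inl ⟨⟨key hy hadj.symm, Finset.mem_union_left _ hy⟩, hadj⟩
    · exact Or.inr ⟨⟨by simpa using hx, by simpa using hy⟩, hadj⟩

/-- Every graph that is dense with respect to `f` has a minimal dense induced subgraph. -/
theorem exists_minimal_dense {n : ℕ} (G : SimpleGraph (Fin n)) (hn : 0 < n) (f : ℕ → ℝ)
    (h : 2 * n * f n ≤ (adjPairs G Finset.univ).card) :
    ∃ m : ℕ, 0 < m ∧ m ≤ n ∧ ∃ e : Fin m ↪ Fin n,
      2 * m * f m ≤ (adjPairs (G.comap e) Finset.univ).card ∧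
      ∀ S : Finset (Fin m), S.Nonempty → S ≠ Finset.univ →
        (adjPairs (G.comap e) S).card < 2 * S.card * f S.card := by
  let 𝓕 := Finset.univ.filter fun W : Finset (Fin n) =>
    W.Nonempty ∧ 2 * W.card * f W.card ≤ (adjPairs G W).card
  obtain ⟨W, hW, hmin⟩ := Finset.exists_min_image 𝓕 Finset.card
    ⟨Finset.univ, by
      have : Nonempty (Fin n) := ⟨⟨0, hn⟩⟩
      simp only [𝓕, Finset.mem_filter, Finset.mem_univ, true_and, Finset.card_univ,
        Fintype.card_fin]
      exact ⟨Finset.univ_nonempty, h⟩⟩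
  simp only [𝓕, Finset.mem_filter, Finset.mem_univ, true_and] at hW hmin
  have hmap : Finset.univ.map (W.orderEmbOfFin rfl).toEmbedding = W := by
    simp
  refine ⟨W.card, hW.1.card_pos, by simpa using W.card_le_univ,
    (W.orderEmbOfFin rfl).toEmbedding, ?_, ?_⟩
  · rw [card_adjPairs_comap, hmap]
    exact hW.2
  · intro S hS hne
    by_contra! hcon
    rw [card_adjPairs_comap, ← Finset.card_map (W.orderEmbOfFin rfl).toEmbedding] at hcon
    have h1 := hmin _ ⟨hS.map, hcon⟩
    rw [Finset.card_map] at h1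
    refine hne (Finset.eq_univ_of_card S (le_antisymm S.card_le_univ ?_))
    simpa using h1

/-- Vertex boundaries in a minimal dense graph. -/
theorem mul_sub_le_of_minimal {f : ℕ → ℝ}
    (huniv : 2 * Fintype.card V * f (Fintype.card V) ≤ (adjPairs G Finset.univ).card)
    (hmin : ∀ S : Finset V, S.Nonempty → S ≠ Finset.univ →
      (adjPairs G S).card < 2 * S.card * f S.card)
    (hmono : ∀ k ≤ Fintype.card V, f k ≤ f (Fintype.card V)) {S : Finset V} (hS : S.Nonempty)
    (hlt : S.card + (outerNbhd G S).card < Fintype.card V) :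
    (S.card + (outerNbhd G S).card : ℝ) *
      (f (Fintype.card V) - f (S.card + (outerNbhd G S).card)) ≤
        (outerNbhd G S).card * f (Fintype.card V) := by
  have hcard : (S ∪ outerNbhd G S).card = S.card + (outerNbhd G S).card := by
    refine Finset.card_union_of_disjoint (Finset.disjoint_left.2 fun x hx hx' => ?_)
    exact (mem_outerNbhd.1 hx').1 hx
  have h1 := hmin (S ∪ outerNbhd G S) (hS.mono Finset.subset_union_left) (fun h => by
    rw [h, Finset.card_univ] at hcard; omega)
  have hSc : Sᶜ.card = Fintype.card V - S.card := Finset.card_compl S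
  have h2 := hmin Sᶜ (Finset.card_pos.1 (by omega)) (fun h => by
    rw [h, Finset.card_univ] at hSc
    have := hS.card_pos
    omega)
  have h3 : ((adjPairs G Finset.univ).card : ℝ) ≤
      (adjPairs G (S ∪ outerNbhd G S)).card + (adjPairs G Sᶜ).card := by
    exact_mod_cast card_adjPairs_univ_le S
  have h4 : (Sᶜ.card : ℝ) * f Sᶜ.card ≤ Sᶜ.card * f (Fintype.card V) :=
    mul_le_mul_of_nonneg_left (hmono _ Sᶜ.card_le_univ) (Nat.cast_nonneg _)
  have h5 : (Sᶜ.card : ℝ) = Fintype.card V - S.card := by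
    rw [hSc, Nat.cast_sub S.card_le_univ]
  rw [h5] at h2 h4
  rw [hcard] at h1
  push_cast at h1
  nlinarith

/-- The density increment used to select an expanding subgraph. -/
noncomputable def increment (k : ℕ) : ℝ := 1 - 1 / √(max 1 (log (log k)))

theorem increment_nonneg (k : ℕ) : 0 ≤ increment k := by
  have h : 1 ≤ √(max 1 (log (log (k : ℝ)))) := one_le_sqrt.2 (le_max_left _ _)
  rw [increment, sub_nonneg, div_le_one (by linarith)]
  exact h

theorem increment_le_one (k : ℕ) : increment k ≤ 1 := by
  rw [increment]
  linarith [show 0 ≤ 1 / √(max 1 (log (log (k : ℝ)))) by positivity]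

theorem inv_sqrt_sub_inv_sqrt {x y : ℝ} (hx : 0 < x) (hxy : x ≤ y) :
    (y - x) / (2 * y * √y) ≤ 1 / √x - 1 / √y := by
  have hy := hx.trans_le hxy
  have hx' := sqrt_pos.2 hx
  have hle := sqrt_le_sqrt hxy
  have hy' := hx'.trans_le hle
  have hsx := sq_sqrt hx.le
  have hsy := sq_sqrt hy.le
  rw [div_sub_div _ _ hx'.ne' hy'.ne', div_le_div_iff₀ (by positivity) (by positivity)]
  generalize √x = p at *
  generalize √y = q at *
  subst hsx hsy
  have h1 : 0 ≤ (q - p) * q := mul_nonneg (by linarith) hy'.le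
  have h2 : (q + p) * p ≤ 2 * q * q := by nlinarith
  nlinarith [mul_le_mul_of_nonneg_left h2 h1]

theorem div_le_increment_sub {m k : ℕ} (hm : 2 ≤ log (log (m : ℝ))) (hk : 1 ≤ k) (hkm : k ≤ m) :
    (log m - log k) / (2 * log m * log (log m) * √(log (log m))) ≤
      increment m - increment k := by
  have hk' : (1 : ℝ) ≤ k := by exact_mod_cast hk
  have hkm' : (k : ℝ) ≤ m := by exact_mod_cast hkm
  have hlogk : 0 ≤ log (k : ℝ) := log_nonneg hk'
  have hlog : log (k : ℝ) ≤ log m := log_le_log (by linarith) hkm'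
  have hL : 0 < log (m : ℝ) := by
    rcases (hlogk.trans hlog).lt_or_eq with h | h
    · exact h
    · rw [← h, log_zero] at hm; linarith
  have key : (log m - log k) / log m ≤ log (log (m : ℝ)) - max 1 (log (log (k : ℝ))) := by
    rcases le_total (log (log (k : ℝ))) 1 with h | h
    · rw [max_eq_left h]
      have : (log m - log k) / log (m : ℝ) ≤ 1 := by rw [div_le_one hL]; linarith
      linarith
    · rw [max_eq_right h]
      have hk0 : 0 < log (k : ℝ) := by
        rcases hlogk.lt_or_eq with h' | h'
        · exact h'
        · rw [← h', log_zero] at h; linarith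
      have h1 := one_sub_inv_le_log_of_pos (div_pos hL hk0)
      rw [log_div hL.ne' hk0.ne', inv_div] at h1
      rwa [sub_div, div_self hL.ne']
  have hle : max 1 (log (log (k : ℝ))) ≤ log (log (m : ℝ)) := by
    have : 0 ≤ (log m - log k) / log (m : ℝ) := div_nonneg (by linarith) hL.le
    linarith
  have h2 := inv_sqrt_sub_inv_sqrt (lt_of_lt_of_le one_pos (le_max_left 1 (log (log (k : ℝ))))) hle
  rw [increment, increment, max_eq_right (by linarith : 1 ≤ log (log (m : ℝ)))]
  have h3 : (log m - log k) / (2 * log m * log (log m) * √(log (log m))) =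
      (log m - log k) / log m / (2 * log (log (m : ℝ)) * √(log (log m))) := by
    rw [div_div]; congr 1; ring
  rw [h3]
  refine le_trans (div_le_div_of_nonneg_right key (by positivity)) (h2.trans (le_of_eq ?_))
  ring

theorem expands_of_minimal {m : ℕ} {G : SimpleGraph (Fin m)} {c ε : ℝ} (hc : 0 < c) (hε : 0 < ε)
    (hm : 2 ≤ log (log (m : ℝ)))
    (huniv : 2 * m * (c + ε / 2 + ε / 2 * increment m) ≤ (adjPairs G Finset.univ).card)
    (hmin : ∀ S : Finset (Fin m), S.Nonempty → S ≠ Finset.univ →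
      (adjPairs G S).card < 2 * S.card * (c + ε / 2 + ε / 2 * increment S.card)) :
    Expands G (ε / (16 * (c + ε)) / (log m * log (log m) * √(log (log m)))) := by
  intro S hS hS2
  rw [Fintype.card_fin] at hS2 ⊢
  obtain ⟨b, hb⟩ : ∃ b, b = log (log (m : ℝ)) := ⟨_, rfl⟩
  have hSpos : 1 ≤ S.card := hS.card_pos
  have hSpos' : (1 : ℝ) ≤ S.card := by exact_mod_cast hSpos
  have hS2' : (2 * S.card : ℝ) ≤ m := by exact_mod_cast hS2
  have hm0 : (0 : ℝ) < m := by linarith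
  have hL : 0 < log (m : ℝ) := log_pos (by linarith)
  have hlogS : 0 ≤ log (S.card : ℝ) := log_nonneg hSpos'
  have hlogdiv : log (m / S.card) = log m - log S.card := log_div hm0.ne' (by linarith)
  have hlog2 : log 2 ≤ log m - log S.card := by
    rw [← hlogdiv]
    exact log_le_log (by norm_num) (by rwa [le_div_iff₀ (by linarith)])
  rw [hlogdiv]
  have hmono : ∀ k ≤ Fintype.card (Fin m), c + ε / 2 + ε / 2 * increment k ≤
      c + ε / 2 + ε / 2 * increment (Fintype.card (Fin m)) := by
    intro k hk
    rw [Fintype.card_fin] at hk ⊢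
    have : increment k ≤ increment m := by
      rcases Nat.eq_zero_or_pos k with rfl | hk0
      · simpa [increment] using increment_nonneg m
      · have h1 := div_le_increment_sub hm hk0 hk
        have h2 : 0 ≤ (log m - log k) / (2 * log m * log (log m) * √(log (log m))) := by
          have h3 : log (k : ℝ) ≤ log m :=
            log_le_log (by exact_mod_cast hk0) (by exact_mod_cast hk)
          have : 0 ≤ log (log (m : ℝ)) := by linarith
          exact div_nonneg (by linarith) (by positivity)
        linarith
    gcongr
  by_cases hN : 4 * (outerNbhd G S).card ≤ S.card
  · have hN' : (4 * (outerNbhd G S).card : ℝ) ≤ S.card := by exact_mod_cast hN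
    have h1 := mul_sub_le_of_minimal (f := fun k => c + ε / 2 + ε / 2 * increment k)
      (by simpa using huniv) hmin hmono hS (by rw [Fintype.card_fin]; omega)
    simp only [Fintype.card_fin] at h1
    have h2 := div_le_increment_sub (k := S.card + (outerNbhd G S).card) hm (by omega) (by omega)
    have h3 : (log m - log S.card) / 4 ≤ log m - log (S.card + (outerNbhd G S).card : ℕ) := by
      have h4 : log ((S.card + (outerNbhd G S).card : ℕ) : ℝ) ≤ log (5 / 4 * S.card) := by
        refine log_le_log (by exact_mod_cast Nat.add_pos_left hSpos _) ?_
        push_cast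
        linarith
      rw [log_mul (by norm_num) (by linarith)] at h4
      have h5 : log (5 / 4 : ℝ) ≤ 1 / 4 := by
        have := log_le_sub_one_of_pos (show (0 : ℝ) < 5 / 4 by norm_num)
        linarith
      linarith [log_two_gt_d9]
    rw [← hb] at h2 hm ⊢
    have hden : 0 < log m * b * √b := by positivity
    have h6 : (log m - log S.card) / (8 * (log m * b * √b)) ≤
        increment m - increment (S.card + (outerNbhd G S).card) := by
      refine le_trans ?_ h2
      rw [div_le_div_iff₀ (by positivity) (by positivity)]
      nlinarith
    have h7 : (S.card : ℝ) * (ε / 2 * ((log m - log S.card) / (8 * (log m * b * √b)))) ≤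
        (outerNbhd G S).card * (c + ε) := by
      have h8 : (outerNbhd G S).card * (c + ε / 2 + ε / 2 * increment m) ≤
          (outerNbhd G S).card * (c + ε) :=
        mul_le_mul_of_nonneg_left (by nlinarith [increment_le_one m]) (Nat.cast_nonneg _)
      refine le_trans ?_ (h1.trans h8)
      have h9 : (0 : ℝ) ≤ (log m - log S.card) / (8 * (log m * b * √b)) :=
        div_nonneg (by linarith [log_two_gt_d9]) (by positivity)
      have h10 : (c + ε / 2 + ε / 2 * increment m -
          (c + ε / 2 + ε / 2 * increment (S.card + (outerNbhd G S).card))) =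
          ε / 2 * (increment m - increment (S.card + (outerNbhd G S).card)) := by ring
      rw [h10]
      gcongr
      linarith [(Nat.cast_nonneg (outerNbhd G S).card : (0 : ℝ) ≤ _)]
    have h11 : ε / (16 * (c + ε)) / (log m * b * √b) * (log m - log S.card) * S.card =
        (S.card : ℝ) * (ε / 2 * ((log m - log S.card) / (8 * (log m * b * √b)))) / (c + ε) := by
      field_simp
      ring
    rw [h11, div_le_iff₀ (by linarith)]
    exact h7
  · have hN' : (S.card : ℝ) ≤ 4 * (outerNbhd G S).card := by exact_mod_cast (not_le.1 hN).le
    rw [← hb] at hm ⊢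
    have hsb : 1 ≤ √b := one_le_sqrt.2 (by linarith)
    have h1 : ε / (16 * (c + ε)) ≤ 1 / 4 := by
      rw [div_le_div_iff₀ (by linarith) (by norm_num)]
      linarith
    have h2 : log m - log S.card ≤ log m * b * √b := by
      have h3 : log (m : ℝ) * 1 * 1 ≤ log m * b * √b := by gcongr; linarith
      linarith
    have h4 : ε / (16 * (c + ε)) / (log m * b * √b) * (log m - log S.card) ≤ 1 / 4 := by
      rw [div_mul_eq_mul_div, div_le_iff₀ (by positivity)]
      exact mul_le_mul h1 h2 (by linarith [log_two_gt_d9]) (by norm_num)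
    have h5 := mul_le_mul_of_nonneg_right h4 (by linarith : (0 : ℝ) ≤ S.card)
    linarith

end MinimalSubgraph

section SmallMinors

theorem log_mul_log_log_pow_mono {m n : ℕ} (hm : 2 ≤ log (log (m : ℝ))) (hm0 : 0 < m)
    (hmn : m ≤ n) :
    log m * log (log m) ^ 3 ≤ log n * log (log (n : ℝ)) ^ 3 := by
  have hm1 : (1 : ℝ) ≤ m := by exact_mod_cast hm0
  have hmn' : (m : ℝ) ≤ n := by exact_mod_cast hmn
  have hlog : log (m : ℝ) ≤ log n := log_le_log (by linarith) hmn'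
  have hL : 0 < log (m : ℝ) := by
    rcases (log_nonneg hm1).lt_or_eq with h | h
    · exact h
    · rw [← h, log_zero] at hm; linarith
  have hloglog : log (log (m : ℝ)) ≤ log (log n) := log_le_log hL hlog
  have h0 : 0 ≤ log (log (m : ℝ)) := by linarith
  have hLn := hL.le.trans hlog
  gcongr

theorem log_mul_log_log_pow_le_logb {x : ℝ} (hx : 0 ≤ log (log x)) (hx0 : 0 < log x) :
    log x * log (log x) ^ 3 ≤ logb 2 x * logb 2 (logb 2 x) ^ 3 := by
  have hlog2 : log 2 ≤ 1 := by linarith [log_two_lt_d9]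
  have hpos : 0 < log (2 : ℝ) := log_pos (by norm_num)
  have key : ∀ {y : ℝ}, 0 ≤ log y → log y ≤ logb 2 y := fun {y} hy => by
    rw [logb, le_div_iff₀ hpos]
    exact mul_le_of_le_one_right hy hlog2
  have h1 : log x ≤ logb 2 x := key hx0.le
  have h2 : log (log x) ≤ log (logb 2 x) := log_le_log hx0 h1
  have h3 : log (log x) ≤ logb 2 (logb 2 x) := h2.trans (key (hx.trans h2))
  have h4 := hx0.le.trans h1
  gcongr

end SmallMinors

/-- Lemma 3.1 (weaker bound): every graph of density at least `c(t) + ε` on sufficiently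
many vertices contains a `K_t`-minor of order `O((c(t)·t²/ε)·log n·(log log n)³)`. -/
theorem stmt_3 :
    ∃ C : ℝ, 0 < C ∧
      ∀ ε : ℝ, 0 < ε → ∀ t : ℕ, 3 ≤ t → ∃ n₁ : ℕ,
        ∀ n : ℕ, n₁ ≤ n → ∀ G : SimpleGraph (Fin n),
          density G ≥ minorThreshold t + ε →
            HasKtMinorOfOrder G t
              (C * (minorThreshold t * t ^ 2 / ε) * logb 2 n * (logb 2 (logb 2 n)) ^ 3) := by
  refine ⟨1, one_pos, fun ε hε t ht => ?_⟩
  have hc : 0 < minorThreshold t := lt_of_lt_of_le (by norm_num) (half_le_minorThreshold ht)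
  have hlogt : Filter.Tendsto (fun n : ℕ => log (n : ℝ)) Filter.atTop Filter.atTop :=
    tendsto_log_atTop.comp tendsto_natCast_atTop_atTop
  have hloglog : Filter.Tendsto (fun n : ℕ => log (log (n : ℝ))) Filter.atTop Filter.atTop :=
    tendsto_log_atTop.comp hlogt
  obtain ⟨c, hceq⟩ : ∃ c, c = minorThreshold t := ⟨_, rfl⟩
  rw [← hceq] at hc ⊢
  have hδ : 0 < c / ε := div_pos hc hε
  have ht0 : (0 : ℝ) < t := by exact_mod_cast (by omega : 0 < t)
  obtain ⟨m₀, hm₀⟩ := exists_forall_hasKtMinorOfOrder (κ := ε / (16 * (c + ε)))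
    (by positivity) (by rw [div_le_one (by positivity)]; linarith) hδ (by omega : 0 < t)
  obtain ⟨m₁, hm₁⟩ := Filter.eventually_atTop.1 (hloglog.eventually_ge_atTop 2)
  obtain ⟨M, hM⟩ : ∃ M, M = max m₀ m₁ := ⟨_, rfl⟩
  obtain ⟨n₁, hn₁⟩ := Filter.eventually_atTop.1
    ((hloglog.eventually_ge_atTop 1).and
      ((hlogt.eventually_ge_atTop (M / (c / ε * t ^ 2))).and
        ((hlogt.eventually_gt_atTop 0).and (Filter.eventually_gt_atTop 0))))
  refine ⟨n₁, fun n hn G hG => ?_⟩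
  obtain ⟨hn2, hnM, hnpos, hn0⟩ := hn₁ n hn
  have hn0' : (0 : ℝ) < n := by exact_mod_cast hn0
  have hbound : c / ε * t ^ 2 * (log n * log (log n) ^ 3) ≤
      1 * (c * t ^ 2 / ε) * logb 2 n * logb 2 (logb 2 n) ^ 3 := by
    have h1 := mul_le_mul_of_nonneg_left
      (log_mul_log_log_pow_le_logb (x := n) (by linarith) hnpos)
      (by positivity : 0 ≤ c / ε * (t : ℝ) ^ 2)
    refine h1.trans (le_of_eq ?_)
    ring
  have hdense : 2 * n * (c + ε / 2 + ε / 2 * increment n) ≤ (adjPairs G Finset.univ).card := by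
    rw [density_fin, ge_iff_le, le_div_iff₀ hn0'] at hG
    have h1 : c + ε / 2 + ε / 2 * increment n ≤ c + ε := by nlinarith [increment_le_one n]
    have h2 := mul_le_mul_of_nonneg_left h1 (by positivity : (0 : ℝ) ≤ 2 * n)
    linarith
  obtain ⟨m, hmpos, hmn, e, hme, hmin⟩ := exists_minimal_dense G hn0
    (fun k => c + ε / 2 + ε / 2 * increment k) hdense
  have hmpos' : (0 : ℝ) < m := by exact_mod_cast hmpos
  refine HasKtMinorOfOrder.mono (HasKtMinorOfOrder.of_comap e ?_) hbound
  by_cases hmM : M ≤ m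
  · have hm2 : 2 ≤ log (log (m : ℝ)) := hm₁ m ((le_max_right _ _).trans (hM ▸ hmM))
    have h1 := hm₀ m ((le_max_left _ _).trans (hM ▸ hmM)) _ (expands_of_minimal hc hε hm2 hme hmin)
    refine h1.mono ?_
    rw [mul_assoc (c / ε * (t : ℝ) ^ 2)]
    exact mul_le_mul_of_nonneg_left (log_mul_log_log_pow_mono hm2 hmpos hmn) (by positivity)
  · have hdens : minorThreshold t < density (G.comap e) := by
      rw [density_fin, lt_div_iff₀ hmpos', ← hceq]
      have h1 := mul_pos hmpos' hε
      have h2 := mul_nonneg h1.le (increment_nonneg m)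
      linarith
    refine (hasKtMinor_of_minorThreshold_lt ht hdens).hasKtMinorOfOrder.mono ?_
    have hmM' : (m : ℝ) ≤ M := by exact_mod_cast (not_le.1 hmM).le
    have h1 : (M : ℝ) ≤ c / ε * t ^ 2 * log n := by
      rwa [div_le_iff₀' (by positivity)] at hnM
    have h2 : log (n : ℝ) ≤ log n * log (log n) ^ 3 :=
      le_mul_of_one_le_right hnpos.le (one_le_pow₀ hn2)
    exact hmM'.trans (h1.trans (mul_le_mul_of_nonneg_left h2 (by positivity)))
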